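/- arXiv:1112.1511 — 2 statements merged into one kernel-verified Lean document; each statement's English description precedes it below -/
import Mathlib

section
/- Let P be a polynomial on ℝⁿ (n ≥ 2) and μ a finite signed measure with support in the closed ball of radius R. Then the rest function R_P has, for |ζ| > R and θ ∈ S^{n-1}, the expansion R_P(ζ,θ) = Σ_{t=0}^∞ Σ_{k=0}^∞ Σ_{m=1}^{a_k} (Y_{k,m}(θ)/ζ^{2t+k+1}) ∫_{ℝⁿ} P(x) |x|^{2t} conj(Y_{k,m}(x)) dμ(x). -/
open MeasureTheory Metric MvPolynomial

noncomputable section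

/-- `ℝⁿ` as a Euclidean space. -/
abbrev En (n : ℕ) : Type := EuclideanSpace ℝ (Fin n)

/-- The Laplace operator `Δ = ∂²/∂x₁² + … + ∂²/∂xₙ²` acting on polynomials. -/
def lap (n : ℕ) (P : MvPolynomial (Fin n) ℂ) : MvPolynomial (Fin n) ℂ :=
  ∑ i : Fin n, pderiv i (pderiv i P)

/-- A polynomial is harmonic if `ΔP = 0`. -/
def IsHarmonicPoly (n : ℕ) (P : MvPolynomial (Fin n) ℂ) : Prop := lap n P = 0

/-- The polyharmonic degree `d(P) = min {N : Δ^(N+1) P = 0}`. -/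
def pdeg (n : ℕ) (P : MvPolynomial (Fin n) ℂ) : ℕ := sInf {N : ℕ | (lap n)^[N + 1] P = 0}

/-- Evaluation of a polynomial at a real point of `ℝⁿ`. -/
def evalR {n : ℕ} (P : MvPolynomial (Fin n) ℂ) (x : En n) : ℂ :=
  eval (fun i => (x i : ℂ)) P

/-- Evaluation of a polynomial at `ζθ`, i.e. after substituting `ζ θ i` for `x i`. -/
def evalC {n : ℕ} (P : MvPolynomial (Fin n) ℂ) (ζ : ℂ) (θ : En n) : ℂ :=
  eval (fun i => ζ * (θ i : ℂ)) P

/-- The surface measure on the unit sphere `S^{n-1} ⊂ ℝⁿ`. -/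
def sphereMeasure (n : ℕ) : Measure (sphere (0 : En n) 1) :=
  (volume : Measure (En n)).toSphere

/-- `ω_n`, the surface area of the unit sphere `S^{n-1}`. -/
def omegaN (n : ℕ) : ℝ := ((sphereMeasure n) Set.univ).toReal

/-- The analytic continuation of `ζ ↦ r(ζθ − x)ⁿ = |ζθ − x|ⁿ` to `|ζ| > |x|`
(principal branch; for real `ζ = ρ > |x|` it equals `|ρθ − x|ⁿ`, for `θ` on the
unit sphere). -/
def rPow (n : ℕ) (ζ : ℂ) (θ x : En n) : ℂ :=
  ζ ^ n * (1 - 2 * ((inner ℝ θ x : ℝ) : ℂ) / ζ + ((‖x‖ : ℂ)) ^ 2 / ζ ^ 2) ^ ((n : ℂ) / 2)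

/-- Integral of a complex-valued function against a finite signed measure
(via the Jordan decomposition). -/
def sInt {α : Type*} [MeasurableSpace α] (μ : SignedMeasure α) (f : α → ℂ) : ℂ :=
  ∫ x, f x ∂μ.toJordanDecomposition.posPart - ∫ x, f x ∂μ.toJordanDecomposition.negPart

/-- The support of the signed measure `μ` is contained in the set `s`. -/
def SuppIn {α : Type*} [MeasurableSpace α] (μ : SignedMeasure α) (s : Set α) : Prop :=
  μ.totalVariation sᶜ = 0

/-- The multivariate Markov transform of a finite signed measure. -/
def markov {n : ℕ} (μ : SignedMeasure (En n)) (ζ : ℂ) (θ : En n) : ℂ :=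
  (omegaN n : ℂ)⁻¹ * sInt μ fun x => ζ ^ (n - 1) / rPow n ζ θ x

/-- The multivariate Markov transform of a (nonnegative) measure. -/
def markovM {n : ℕ} (μ : Measure (En n)) (ζ : ℂ) (θ : En n) : ℂ :=
  (omegaN n : ℂ)⁻¹ * ∫ x, ζ ^ (n - 1) / rPow n ζ θ x ∂μ

/-- The function of the second kind `Q_P` for a signed measure. -/
def qP {n : ℕ} (μ : SignedMeasure (En n)) (P : MvPolynomial (Fin n) ℂ) (ζ : ℂ) (θ : En n) : ℂ :=
  (omegaN n : ℂ)⁻¹ * sInt μ fun x => (evalC P ζ θ - evalR P x) * ζ ^ (n - 1) / rPow n ζ θ x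

/-- The function of the second kind `Q_P` for a (nonnegative) measure. -/
def qPM {n : ℕ} (μ : Measure (En n)) (P : MvPolynomial (Fin n) ℂ) (ζ : ℂ) (θ : En n) : ℂ :=
  (omegaN n : ℂ)⁻¹ * ∫ x, (evalC P ζ θ - evalR P x) * ζ ^ (n - 1) / rPow n ζ θ x ∂μ

/-- The rest function `R_P` for a signed measure. -/
def restP {n : ℕ} (μ : SignedMeasure (En n)) (P : MvPolynomial (Fin n) ℂ) (ζ : ℂ) (θ : En n) : ℂ :=
  (omegaN n : ℂ)⁻¹ * sInt μ fun x => evalR P x * ζ ^ (n - 1) / rPow n ζ θ x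

namespace RestAux

/-- Gaussian weight. -/
def gw {n : ℕ} (x : En n) : ℂ := ((Real.exp (-(1/2) * ‖x‖ ^ 2) : ℝ) : ℂ)

/-- Gaussian functional on polynomials. -/
def gE (n : ℕ) (p : MvPolynomial (Fin n) ℂ) : ℂ := ∫ x : En n, evalR p x * gw x

lemma evalR_add {n : ℕ} (p q : MvPolynomial (Fin n) ℂ) (x : En n) :
    evalR (p + q) x = evalR p x + evalR q x := by simp [evalR]
lemma evalR_sub {n : ℕ} (p q : MvPolynomial (Fin n) ℂ) (x : En n) :
    evalR (p - q) x = evalR p x - evalR q x := by simp [evalR]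
lemma evalR_mul {n : ℕ} (p q : MvPolynomial (Fin n) ℂ) (x : En n) :
    evalR (p * q) x = evalR p x * evalR q x := by simp [evalR]
lemma evalR_pow {n : ℕ} (p : MvPolynomial (Fin n) ℂ) (k : ℕ) (x : En n) :
    evalR (p ^ k) x = evalR p x ^ k := by simp [evalR]
lemma evalR_C {n : ℕ} (c : ℂ) (x : En n) : evalR (C c) x = c := by simp [evalR]
lemma evalR_X {n : ℕ} (i : Fin n) (x : En n) : evalR (X i) x = (x i : ℂ) := by simp [evalR]
lemma evalR_sum {n : ℕ} {ι : Type*} (s : Finset ι) (p : ι → MvPolynomial (Fin n) ℂ) (x : En n) :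
    evalR (∑ i ∈ s, p i) x = ∑ i ∈ s, evalR (p i) x := by simp [evalR]
lemma evalR_smul {n : ℕ} (c : ℂ) (p : MvPolynomial (Fin n) ℂ) (x : En n) :
    evalR (c • p) x = c * evalR p x := by simp [evalR]

lemma evalR_hom {n d : ℕ} {p : MvPolynomial (Fin n) ℂ} (hp : p.IsHomogeneous d) (r : ℝ) (x : En n) :
    evalR p (r • x) = (r : ℂ) ^ d * evalR p x := by
  unfold evalR
  rw [eval_eq', eval_eq', Finset.mul_sum]
  refine Finset.sum_congr rfl fun e he => ?_
  have h := hp (mem_support_iff.1 he)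
  have h2 : ∑ i, e i = d := by
    rw [← h, Finsupp.weight_apply, Finsupp.sum_fintype _ _ (by simp)]; simp
  simp only [PiLp.smul_apply, smul_eq_mul, Complex.ofReal_mul, mul_pow, Finset.prod_mul_distrib,
    Finset.prod_pow_eq_pow_sum, h2]
  ring

lemma hasFDerivAt_evalR {n : ℕ} (p : MvPolynomial (Fin n) ℂ) (x : En n) :
    ∃ f' : En n →L[ℝ] ℂ, HasFDerivAt (evalR p) f' x ∧
      ∀ i, f' (EuclideanSpace.single i 1) = evalR (pderiv i p) x := by
  induction p using MvPolynomial.induction_on with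
  | C a =>
    refine ⟨0, ?_, ?_⟩
    · have : (evalR (C a) : En n → ℂ) = fun _ => a := by ext; simp [evalR]
      rw [this]; exact hasFDerivAt_const _ _
    · intro i; simp [evalR]
  | add p q hp hq =>
    obtain ⟨f, hf, hf'⟩ := hp
    obtain ⟨g, hg, hg'⟩ := hq
    refine ⟨f + g, ?_, ?_⟩
    · have : (evalR (p + q) : En n → ℂ) = fun x => evalR p x + evalR q x := by
        ext; simp [evalR]
      rw [this]; exact hf.add hg
    · intro i; simp [hf', hg', evalR]
  | mul_X p j hp =>
    obtain ⟨f, hf, hf'⟩ := hp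
    have hX : HasFDerivAt (fun y : En n => ((y j : ℝ) : ℂ))
        (Complex.ofRealCLM.comp (EuclideanSpace.proj j : En n →L[ℝ] ℝ)) x :=
      (Complex.ofRealCLM.comp (EuclideanSpace.proj j : En n →L[ℝ] ℝ)).hasFDerivAt
    have : (evalR (p * X j) : En n → ℂ) = fun x => evalR p x * ((x j : ℝ) : ℂ) := by
      ext; simp [evalR]
    rw [this]
    refine ⟨_, hf.mul hX, ?_⟩
    intro i
    by_cases h : j = i
    · subst h; simp [hf', evalR]
    · simp [hf', evalR, h, pderiv_X]

lemma continuous_evalR {n : ℕ} (p : MvPolynomial (Fin n) ℂ) : Continuous (evalR p : En n → ℂ) := by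
  rw [continuous_iff_continuousAt]
  intro x
  obtain ⟨f, hf, -⟩ := hasFDerivAt_evalR p x
  exact hf.continuousAt

lemma evalR_bound {n : ℕ} (p : MvPolynomial (Fin n) ℂ) :
    ∀ b : ℝ, 0 < b → ∃ c : ℝ, 0 ≤ c ∧ ∀ x : En n, ‖evalR p x‖ ≤ c * Real.exp (b * ‖x‖ ^ 2) := by
  induction p using MvPolynomial.induction_on with
  | C a =>
    intro b hb
    refine ⟨‖a‖, norm_nonneg _, fun x => ?_⟩
    rw [evalR_C]
    have : 1 ≤ Real.exp (b * ‖x‖ ^ 2) := Real.one_le_exp (by positivity)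
    nlinarith [norm_nonneg a]
  | add p q hp hq =>
    intro b hb
    obtain ⟨c, hc, h⟩ := hp b hb
    obtain ⟨d, hd, h'⟩ := hq b hb
    refine ⟨c + d, by positivity, fun x => ?_⟩
    rw [evalR_add]
    calc _ ≤ _ := norm_add_le _ _
      _ ≤ _ := by rw [add_mul]; exact add_le_add (h x) (h' x)
  | mul_X p j hp =>
    intro b hb
    obtain ⟨c, hc, h⟩ := hp (b/2) (by positivity)
    refine ⟨c * (1 + 1/(b/2)), by positivity, fun x => ?_⟩
    rw [evalR_mul, evalR_X, norm_mul]
    have h1 : ‖((x j : ℝ) : ℂ)‖ ≤ ‖x‖ := by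
      rw [Complex.norm_real]; exact PiLp.norm_apply_le x j
    have h2 : ‖x‖ ≤ (1 + 1/(b/2)) * Real.exp (b/2 * ‖x‖^2) := by
      have h3 := Real.add_one_le_exp (b/2 * ‖x‖^2)
      calc ‖x‖ ≤ 1 + ‖x‖^2 := by nlinarith [sq_nonneg (‖x‖ - 1), norm_nonneg x]
        _ ≤ (1 + 1/(b/2)) * (b/2 * ‖x‖^2 + 1) := by
          have : (1 + 1/(b/2)) * (b/2 * ‖x‖^2 + 1) = 1 + ‖x‖^2 + b/2 * ‖x‖^2 + 1/(b/2) := by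
            field_simp; ring
          rw [this]; have : 0 ≤ b/2 * ‖x‖^2 := by positivity
          have : 0 ≤ 1/(b/2) := by positivity
          linarith
        _ ≤ _ := by gcongr
    calc _ ≤ (c * Real.exp (b/2 * ‖x‖ ^ 2)) * ((1 + 1/(b/2)) * Real.exp (b/2 * ‖x‖^2)) := by
          gcongr
          · exact h x
          · exact h1.trans h2
      _ = _ := by
        rw [show b * ‖x‖^2 = b/2 * ‖x‖^2 + b/2 * ‖x‖^2 by ring, Real.exp_add]; ring

lemma continuous_gw {n : ℕ} : Continuous (gw : En n → ℂ) := by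
  unfold gw; fun_prop

lemma integrable_gE {n : ℕ} (p : MvPolynomial (Fin n) ℂ) :
    Integrable (fun x : En n => evalR p x * gw x) := by
  obtain ⟨c, hc, h⟩ := evalR_bound p (1/4) (by norm_num)
  have hi : Integrable (fun x : En n => Complex.exp (-(1/4 : ℂ) * ‖x‖^2 + 0 * (inner ℝ (0 : En n) x : ℝ))) :=
    GaussianFourier.integrable_cexp_neg_mul_sq_norm_add (by norm_num) 0 0
  refine (hi.norm.const_mul c).mono' ((continuous_evalR p).mul continuous_gw).aestronglyMeasurable ?_
  filter_upwards with x
  rw [norm_mul]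
  have e1 : ‖gw x‖ = Real.exp (-(1/2) * ‖x‖ ^ 2) := by
    rw [gw, Complex.norm_real, Real.norm_eq_abs, abs_of_pos (Real.exp_pos _)]
  have e2 : ‖Complex.exp (-(1/4 : ℂ) * ‖x‖^2 + 0 * (inner ℝ (0 : En n) x : ℝ))‖ =
      Real.exp (-(1/4) * ‖x‖^2) := by
    rw [Complex.norm_exp]; congr 1
    have : (-(1/4 : ℂ) * ‖x‖^2 + 0 * (inner ℝ (0 : En n) x : ℝ)) = ((-(1/4) * ‖x‖^2 : ℝ) : ℂ) := by
      push_cast; ring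
    rw [this, Complex.ofReal_re]
  rw [e1, e2]
  calc _ ≤ (c * Real.exp (1/4 * ‖x‖ ^ 2)) * Real.exp (-(1/2) * ‖x‖ ^ 2) := by
        gcongr; exact h x
    _ = _ := by
        rw [mul_assoc, ← Real.exp_add]; congr 2; ring

lemma gE_add {n : ℕ} (p q : MvPolynomial (Fin n) ℂ) : gE n (p + q) = gE n p + gE n q := by
  unfold gE
  rw [← integral_add (integrable_gE p) (integrable_gE q)]
  congr 1; ext x; rw [evalR_add]; ring

lemma gE_smul {n : ℕ} (c : ℂ) (p : MvPolynomial (Fin n) ℂ) : gE n (c • p) = c * gE n p := by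
  unfold gE
  rw [← integral_const_mul]
  congr 1; ext x; rw [evalR_smul]; ring

/-- `gE` as a linear map. -/
def gEl (n : ℕ) : MvPolynomial (Fin n) ℂ →ₗ[ℂ] ℂ where
  toFun := gE n
  map_add' := gE_add
  map_smul' := by intro c p; simp [gE_smul]

lemma hasFDerivAt_gw {n : ℕ} (x : En n) :
    ∃ f' : En n →L[ℝ] ℂ, HasFDerivAt (gw : En n → ℂ) f' x ∧
      ∀ i, f' (EuclideanSpace.single i 1) = - (x i : ℂ) * gw x := by
  have h1 : HasFDerivAt (fun y : En n => ‖y‖ ^ 2) (2 • (innerSL ℝ x)) x := by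
    exact (hasStrictFDerivAt_norm_sq x).hasFDerivAt
  have h2 := ((h1.const_mul (-(1/2))).exp)
  have h3 := Complex.ofRealCLM.hasFDerivAt.comp x h2
  refine ⟨_, h3, fun i => ?_⟩
  simp [gw, EuclideanSpace.inner_single_right]
  ring

lemma gE_ibp {n : ℕ} (i : Fin n) (p : MvPolynomial (Fin n) ℂ) :
    gE n (X i * p) = gE n (pderiv i p) := by
  have key : ∀ x : En n, HasFDerivAt (fun x => evalR p x * gw x)
      (fderiv ℝ (fun x => evalR p x * gw x) x) x ∧
      fderiv ℝ (fun x => evalR p x * gw x) x (EuclideanSpace.single i 1) =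
        evalR (pderiv i p - X i * p) x * gw x := by
    intro x
    obtain ⟨f, hf, hf'⟩ := hasFDerivAt_evalR p x
    obtain ⟨g, hg, hg'⟩ := hasFDerivAt_gw x
    have : HasFDerivAt (fun x => evalR p x * gw x) _ x := hf.mul hg
    refine ⟨this.differentiableAt.hasFDerivAt, ?_⟩
    rw [HasFDerivAt.fderiv this]
    simp [hf', hg', evalR_sub, evalR_mul, evalR_X]
    ring
  have := integral_mul_fderiv_eq_neg_fderiv_mul_of_integrable (μ := (volume : Measure (En n)))
    (f := fun _ => (1 : ℂ)) (g := fun x => evalR p x * gw x) (v := EuclideanSpace.single i 1)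
    (by simp) (by simpa [(key _).2] using integrable_gE _) (by simpa using integrable_gE _)
    (by intros; simp) (fun x _ => (key x).1.differentiableAt)
  simp only [(key _).2, one_mul, fderiv_fun_const] at this
  have h2 : gE n (pderiv i p - X i * p) = 0 := by
    rw [gE, this]; simp
  have h3 := (gEl n).map_sub (pderiv i p) (X i * p)
  change gE n _ = gE n _ - gE n _ at h3
  rw [h2] at h3
  exact (sub_eq_zero.1 h3.symm).symm

lemma gE_one_ne {n : ℕ} : gE n 1 ≠ 0 := by
  have h1 : gE n 1 = ((∫ x : En n, Real.exp (-(1/2) * ‖x‖ ^ 2) : ℝ) : ℂ) := by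
    rw [gE, ← integral_complex_ofReal]
    simp [evalR, gw]
  have hi : Integrable (fun x : En n => Real.exp (-(1/2) * ‖x‖ ^ 2)) := by
    have := (integrable_gE (n := n) 1).norm
    simpa [evalR, gw, ← Complex.ofReal_exp, Complex.norm_exp] using! this
  rw [h1]
  have := integral_exp_pos (μ := (volume : Measure (En n))) (f := fun x => -(1/2) * ‖x‖^2) hi
  exact_mod_cast (ne_of_gt this)

/-- radial factor -/
def rad (n d : ℕ) : ℂ :=
  ∫ r : Set.Ioi (0 : ℝ), ((r : ℝ) : ℂ) ^ d * ((Real.exp (-(1/2) * (r : ℝ) ^ 2) : ℝ) : ℂ)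
    ∂(Measure.volumeIoiPow (n - 1))

lemma gE_polar {n d : ℕ} (hn : 2 ≤ n) {p : MvPolynomial (Fin n) ℂ} (hp : p.IsHomogeneous d) :
    gE n p = rad n d * ∫ θ : sphere (0 : En n) 1, evalR p (θ : En n) ∂(sphereMeasure n) := by
  have : Nontrivial (En n) := by
    have : Nonempty (Fin n) := ⟨⟨0, by omega⟩⟩
    infer_instance
  have h1 := (volume : Measure (En n)).measurePreserving_homeomorphUnitSphereProd.integral_comp
    (Homeomorph.measurableEmbedding _) (fun z => evalR p (z.1 : En n) *
      (((z.2 : ℝ) : ℂ) ^ d * ((Real.exp (-(1/2) * (z.2 : ℝ) ^ 2) : ℝ) : ℂ)))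
  rw [integral_prod_mul (fun z : sphere (0 : En n) 1 => evalR p (z : En n))
    (fun z : Set.Ioi (0 : ℝ) => (((z : ℝ) : ℂ) ^ d * ((Real.exp (-(1/2) * (z : ℝ) ^ 2) : ℝ) : ℂ)))] at h1
  rw [finrank_euclideanSpace_fin] at h1
  rw [mul_comm, rad, sphereMeasure, ← h1]
  have h2 := integral_subtype_comap (μ := (volume : Measure (En n)))
    (measurableSet_singleton (0 : En n)).compl (fun y : En n => evalR p y * gw y)
  rw [restrict_compl_singleton] at h2
  rw [gE, ← h2]
  refine integral_congr_ae (Filter.Eventually.of_forall fun y => ?_)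
  have hy : ‖(y : En n)‖ ≠ 0 := norm_ne_zero_iff.2 y.2
  have e1 : ((homeomorphUnitSphereProd (En n) y).2 : ℝ) = ‖(y : En n)‖ := by simp
  have e2 : ((homeomorphUnitSphereProd (En n) y).1 : En n) = ‖(y : En n)‖⁻¹ • (y : En n) := by simp
  simp only [e1, e2]
  rw [evalR_hom hp, gw]
  have hy' : ((‖(y : En n)‖ : ℝ) : ℂ) ≠ 0 := by exact_mod_cast hy
  rw [Complex.ofReal_inv, inv_pow]
  field_simp

end RestAux

namespace RestAux

lemma pderiv_comm' {n : ℕ} (i j : Fin n) (p : MvPolynomial (Fin n) ℂ) :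
    pderiv i (pderiv j p) = pderiv j (pderiv i p) := by
  have h : ⁅(pderiv i : Derivation ℂ (MvPolynomial (Fin n) ℂ) (MvPolynomial (Fin n) ℂ)), pderiv j⁆ = (0 : Derivation ℂ (MvPolynomial (Fin n) ℂ) (MvPolynomial (Fin n) ℂ)) := by
    apply MvPolynomial.derivation_ext
    intro k
    simp only [Derivation.commutator_apply, pderiv_X, Derivation.zero_apply]
    rw [Pi.single_apply, Pi.single_apply]
    split_ifs <;> simp
  have := congrArg (fun D => D p) h
  simp only [Derivation.commutator_apply, Derivation.zero_apply] at this
  exact sub_eq_zero.1 this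

lemma harm_pderiv {n : ℕ} {H : MvPolynomial (Fin n) ℂ} (h : IsHarmonicPoly n H) (i : Fin n) :
    IsHarmonicPoly n (pderiv i H) := by
  unfold IsHarmonicPoly lap at *
  simp_rw [pderiv_comm' _ i, ← map_sum, h, map_zero]

lemma gE_zero {n : ℕ} : gE n 0 = 0 := (gEl n).map_zero
lemma gE_sum {n : ℕ} {ι : Type*} (s : Finset ι) (p : ι → MvPolynomial (Fin n) ℂ) :
    gE n (∑ i ∈ s, p i) = ∑ i ∈ s, gE n (p i) := map_sum (gEl n) _ _
lemma gE_nsmul {n : ℕ} (c : ℕ) (p : MvPolynomial (Fin n) ℂ) :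
    gE n (c • p) = c * gE n p := by
  rw [← nsmul_eq_mul]; exact map_nsmul (gEl n) c p

lemma gE_harm {n k : ℕ} {H : MvPolynomial (Fin n) ℂ} (hk : 0 < k) (hH : H.IsHomogeneous k)
    (h : IsHarmonicPoly n H) : gE n H = 0 := by
  have h1 := hH.sum_X_mul_pderiv
  have h2 : gE n (k • H) = 0 := by
    rw [← h1, gE_sum]
    simp_rw [gE_ibp]
    rw [← gE_sum]
    change gE n (lap n H) = 0
    rw [h, gE_zero]
  rw [gE_nsmul] at h2
  have : (k : ℂ) ≠ 0 := by exact_mod_cast hk.ne'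
  exact (mul_eq_zero.1 h2).resolve_left this

lemma gE_orth {n : ℕ} : ∀ (j k : ℕ) (p H : MvPolynomial (Fin n) ℂ), j < k → p.IsHomogeneous j →
    H.IsHomogeneous k → IsHarmonicPoly n H → gE n (p * H) = 0 := by
  intro j
  induction j using Nat.strong_induction_on with
  | _ j ih =>
  intro k p H hjk hp hH h
  rcases Nat.eq_zero_or_pos j with rfl | hj
  · rw [← totalDegree_zero_iff_isHomogeneous, totalDegree_eq_zero_iff_eq_C] at hp
    rw [hp, C_mul', gE_smul, gE_harm hjk hH h, mul_zero]
  have h2 : gE n ((j • p) * H) = 0 := by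
    rw [← hp.sum_X_mul_pderiv, Finset.sum_mul, gE_sum]
    refine Finset.sum_eq_zero fun i _ => ?_
    rw [mul_assoc, gE_ibp, Derivation.leibniz, smul_eq_mul, smul_eq_mul, gE_add,
      ih (j - 1) (by omega) (k - 1) _ _ (by omega) hp.pderiv hH.pderiv (harm_pderiv h i), mul_comm,
      zero_add]
    exact ih (j - 1 - 1) (by omega) k _ _ (by omega) hp.pderiv.pderiv hH h
  rw [smul_mul_assoc, gE_nsmul] at h2
  have : (j : ℂ) ≠ 0 := by exact_mod_cast hj.ne'
  exact (mul_eq_zero.1 h2).resolve_left this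

/-- The linear form `⟨θ, x⟩`. -/
def lin {n : ℕ} (θ : En n) : MvPolynomial (Fin n) ℂ := ∑ i, C (θ i : ℂ) * X i

/-- `|x|²` -/
def nsq (n : ℕ) : MvPolynomial (Fin n) ℂ := ∑ i, X i ^ 2

lemma lin_hom {n : ℕ} (θ : En n) : (lin θ).IsHomogeneous 1 :=
  IsHomogeneous.sum _ _ _ fun i _ => by
    simpa using (isHomogeneous_C (Fin n) (θ i : ℂ)).mul (isHomogeneous_X ℂ i)

lemma nsq_hom (n : ℕ) : (nsq n).IsHomogeneous 2 :=
  IsHomogeneous.sum _ _ _ fun i _ => by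
    simpa using (isHomogeneous_X ℂ i).pow 2

lemma evalR_lin {n : ℕ} (θ x : En n) : evalR (lin θ) x = ((inner ℝ θ x : ℝ) : ℂ) := by
  simp [lin, evalR, PiLp.inner_apply, mul_comm]

lemma evalR_nsq {n : ℕ} (x : En n) : evalR (nsq n) x = (‖x‖ : ℂ) ^ 2 := by
  simp only [nsq, evalR, map_sum, map_pow, eval_X]
  rw [← Complex.ofReal_pow, EuclideanSpace.norm_sq_eq]
  simp

lemma pderiv_lin {n : ℕ} (θ : En n) (i : Fin n) : pderiv i (lin θ) = C (θ i : ℂ) := by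
  simp [lin, pderiv_X, Pi.single_apply]

lemma pderiv_nsq {n : ℕ} (i : Fin n) : pderiv i (nsq n) = 2 * X i := by
  simp [nsq, pderiv_X, Pi.single_apply, Derivation.leibniz_pow]

/-- directional derivative -/
def dir {n : ℕ} (θ : En n) (p : MvPolynomial (Fin n) ℂ) : MvPolynomial (Fin n) ℂ :=
  ∑ i, C (θ i : ℂ) * pderiv i p

lemma gE_lin {n : ℕ} (θ : En n) (p : MvPolynomial (Fin n) ℂ) :
    gE n (lin θ * p) = gE n (dir θ p) := by
  simp only [lin, dir, Finset.sum_mul, gE_sum, C_mul', gE_smul, gE_ibp, smul_mul_assoc]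

lemma gE_lin_pow {n : ℕ} (θ : En n) : ∀ (k : ℕ) (H : MvPolynomial (Fin n) ℂ), H.IsHomogeneous k →
    IsHarmonicPoly n H → gE n (lin θ ^ k * H) = k.factorial * evalR H θ * gE n 1 := by
  intro k
  induction k with
  | zero =>
    intro H hH _
    rw [← totalDegree_zero_iff_isHomogeneous, totalDegree_eq_zero_iff_eq_C] at hH
    rw [hH, evalR_C]
    have : lin θ ^ 0 * C (coeff 0 H) = (coeff 0 H) • (1 : MvPolynomial (Fin n) ℂ) := by
      rw [pow_zero, one_mul, ← C_mul', mul_one]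
    rw [this, gE_smul]; simp
  | succ k ih =>
    intro H hH h
    have e1 : dir θ (lin θ ^ k * H) = dir θ (lin θ ^ k) * H + lin θ ^ k * dir θ H := by
      simp only [dir, Derivation.leibniz, smul_eq_mul, mul_add, Finset.sum_add_distrib,
        Finset.sum_mul, Finset.mul_sum]
      rw [add_comm]; congr 1 <;> refine Finset.sum_congr rfl fun i _ => by ring
    have h1 : (dir θ (lin θ ^ k)).IsHomogeneous (k - 1) :=
      IsHomogeneous.sum _ _ _ fun i _ => by
        simpa using (isHomogeneous_C (Fin n) (θ i : ℂ)).mul ((lin_hom θ).pow k).pderiv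
    have h2 : (dir θ H).IsHomogeneous k :=
      IsHomogeneous.sum _ _ _ fun i _ => by
        simpa using (isHomogeneous_C (Fin n) (θ i : ℂ)).mul hH.pderiv
    have h3 : IsHarmonicPoly n (dir θ H) := by
      have := fun i => harm_pderiv h i
      unfold IsHarmonicPoly lap at *
      simp only [dir, map_sum, pderiv_C_mul]
      rw [Finset.sum_comm]
      refine Finset.sum_eq_zero fun i _ => ?_
      simp_rw [C_mul', ← Finset.smul_sum]
      rw [this i, smul_zero]
    have h4 : evalR (dir θ H) θ = (k + 1 : ℕ) * evalR H θ := by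
      have := congrArg (fun p => evalR p θ) hH.sum_X_mul_pderiv
      simp only [nsmul_eq_mul, evalR_sum, evalR_mul, evalR_X] at this
      simp only [dir, evalR_sum, evalR_mul, evalR_C, this]
      simp [evalR]
    rw [pow_succ', mul_assoc, gE_lin, e1, gE_add, gE_orth (k - 1) (k + 1) _ _ (by omega) h1 hH h,
      ih _ h2 h3, h4, Nat.factorial_succ]
    push_cast; ring

lemma gE_nsq_pow {n : ℕ} (k : ℕ) :
    gE n (nsq n ^ k) = (∏ l ∈ Finset.range k, ((n : ℂ) + 2 * l)) * gE n 1 := by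
  induction k with
  | zero => simp
  | succ k ih =>
    rw [Finset.prod_range_succ, pow_succ']
    have h1 : gE n (nsq n * nsq n ^ k) = ∑ i, gE n (nsq n ^ k + X i * pderiv i (nsq n ^ k)) := by
      conv_lhs => rw [nsq, Finset.sum_mul, gE_sum]
      refine Finset.sum_congr rfl fun i _ => ?_
      rw [pow_two, mul_assoc, gE_ibp, Derivation.leibniz]
      congr 1; simp [nsq]; ring
    rw [h1, ← gE_sum, Finset.sum_add_distrib, ((nsq_hom n).pow k).sum_X_mul_pderiv]
    simp only [Finset.sum_const, Finset.card_univ, Fintype.card_fin, gE_add, gE_nsmul, ih]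
    push_cast; ring

lemma omegaN_pos {n : ℕ} (hn : 2 ≤ n) : 0 < omegaN n := by
  have : Nontrivial (En n) := by
    have : Nonempty (Fin n) := ⟨⟨0, by omega⟩⟩
    infer_instance
  have h : (sphereMeasure n) Set.univ ≠ 0 := by
    rw [Ne, Measure.measure_univ_eq_zero]
    exact Measure.toSphere_ne_zero _
  have : IsFiniteMeasure (sphereMeasure n) := by unfold sphereMeasure; infer_instance
  exact ENNReal.toReal_pos h (measure_ne_top _ _)

lemma rad_even {n : ℕ} (hn : 2 ≤ n) (k : ℕ) :
    rad n (2 * k) * omegaN n = (∏ l ∈ Finset.range k, ((n : ℂ) + 2 * l)) * gE n 1 := by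
  rw [← gE_nsq_pow, gE_polar hn ((nsq_hom n).pow k)]
  simp only [evalR_pow, evalR_nsq]
  simp [omegaN, Measure.real]

lemma prod_ne {n : ℕ} (hn : 2 ≤ n) (k : ℕ) : (∏ l ∈ Finset.range k, ((n : ℂ) + 2 * l)) ≠ 0 := by
  rw [Finset.prod_ne_zero_iff]
  intro l _
  have : n + 2 * l ≠ 0 := by omega
  exact_mod_cast this

lemma rad_ne {n : ℕ} (hn : 2 ≤ n) (k : ℕ) : rad n (2 * k) ≠ 0 := by
  have h := rad_even hn k
  have h2 := mul_ne_zero (prod_ne hn k) (gE_one_ne (n := n))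
  rw [← h] at h2
  exact left_ne_zero_of_mul h2

lemma sphere_int_low {n : ℕ} (hn : 2 ≤ n) (θ : En n) {k j : ℕ} (hj : 0 < j) (hjk : 2 * j ≤ k)
    {H : MvPolynomial (Fin n) ℂ} (hH : H.IsHomogeneous k) (h : IsHarmonicPoly n H) :
    ∫ η : sphere (0 : En n) 1, evalR (lin θ ^ (k - 2 * j) * nsq n ^ j * H) (η : En n) ∂(sphereMeasure n)
      = 0 := by
  have h1 : ((lin θ) ^ (k - 2 * j)).IsHomogeneous (k - 2 * j) := by
    simpa using (lin_hom θ).pow (k - 2 * j)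
  have h2 := gE_orth (k - 2 * j) k _ H (by omega) h1 hH h
  rw [gE_polar hn (h1.mul hH), show k - 2 * j + k = 2 * (k - j) by omega] at h2
  have h3 := (mul_eq_zero.1 h2).resolve_left (rad_ne hn _)
  rw [← h3]
  congr 1; ext η
  simp [evalR_mul, evalR_pow, evalR_nsq]

lemma sphere_int_top {n : ℕ} (hn : 2 ≤ n) (θ : En n) {k : ℕ}
    {H : MvPolynomial (Fin n) ℂ} (hH : H.IsHomogeneous k) (h : IsHarmonicPoly n H) :
    ((∏ l ∈ Finset.range k, ((n : ℂ) + 2 * l)) / k.factorial) *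
    ∫ η : sphere (0 : En n) 1, evalR (lin θ ^ k * H) (η : En n) ∂(sphereMeasure n)
      = omegaN n * evalR H θ := by
  have h1 : ((lin θ) ^ k).IsHomogeneous k := by simpa using (lin_hom θ).pow k
  have h2 := gE_lin_pow θ k H hH h
  rw [gE_polar hn (h1.mul hH), show k + k = 2 * k by omega] at h2
  have h3 := rad_even hn k
  have h4 := gE_one_ne (n := n)
  have h5 : (k.factorial : ℂ) ≠ 0 := by exact_mod_cast k.factorial_ne_zero
  have h6 := rad_ne hn k
  set I := ∫ η : sphere (0 : En n) 1, evalR (lin θ ^ k * H) (η : En n) ∂(sphereMeasure n)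
  set Pr := (∏ l ∈ Finset.range k, ((n : ℂ) + 2 * l))
  rw [div_mul_eq_mul_div, div_eq_iff h5]
  apply mul_left_cancel₀ h4
  linear_combination (omegaN n : ℂ) * h2 - I * h3

end RestAux

namespace RestAux

/-- Pochhammer symbol. -/
def pz (l : ℝ) (m : ℕ) : ℝ := ∏ i ∈ Finset.range m, (l + i)

lemma pz_succ (l : ℝ) (m : ℕ) : pz l (m + 1) = pz l m * (l + m) := Finset.prod_range_succ _ _

/-- Coefficients of the zonal harmonics. -/
def bq (l : ℝ) (k j : ℕ) : ℝ :=
  if k = 0 then (if j = 0 then 1 else 0) else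
  if 2 * j ≤ k then (-1) ^ j * 2 ^ (k - 2 * j) * pz l (k - j - 1) * (l + k - 1) /
    (j.factorial * (k - 2 * j).factorial) else 0

/-- Zonal harmonic, as a function of `s = ⟨θ,x⟩` and `q = |x|²`. -/
def Qr (l s q : ℝ) (k : ℕ) : ℝ := ∑ j ∈ Finset.range (k + 1), bq l k j * (s ^ (k - 2 * j) * q ^ j)

/-- Zonal harmonic, as a polynomial. -/
def Qp {n : ℕ} (θ : En n) (k : ℕ) : MvPolynomial (Fin n) ℂ :=
  ∑ j ∈ Finset.range (k + 1), C ((bq (n / 2) k j : ℝ) : ℂ) * (lin θ ^ (k - 2 * j) * nsq n ^ j)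

lemma bq_pos {l : ℝ} {k j : ℕ} (hk : k ≠ 0) (h : 2 * j ≤ k) : bq l k j =
    (-1) ^ j * 2 ^ (k - 2 * j) * pz l (k - j - 1) * (l + k - 1) /
    (j.factorial * (k - 2 * j).factorial) := by
  unfold bq; rw [if_neg hk, if_pos h]

lemma bq_big {l : ℝ} {k j : ℕ} (h : k < 2 * j) : bq l k j = 0 := by
  unfold bq
  split_ifs <;> first | rfl | omega

lemma evalR_Qp {n : ℕ} (θ x : En n) (k : ℕ) :
    evalR (Qp θ k) x = ((Qr (n / 2) (inner ℝ θ x) (‖x‖ ^ 2) k : ℝ) : ℂ) := by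
  simp only [Qp, Qr, evalR_sum, evalR_mul, evalR_C, evalR_pow, evalR_lin, evalR_nsq]
  push_cast; rfl

lemma Qp_hom {n : ℕ} (θ : En n) (k : ℕ) : (Qp θ k).IsHomogeneous k := by
  refine IsHomogeneous.sum _ _ _ fun j _ => ?_
  by_cases h : 2 * j ≤ k
  · have := (isHomogeneous_C (Fin n) ((bq (n / 2) k j : ℝ) : ℂ)).mul
      (((lin_hom θ).pow (k - 2 * j)).mul ((nsq_hom n).pow j))
    rwa [show 0 + (1 * (k - 2 * j) + 2 * j) = k by omega] at this
  · rw [bq_big (by omega)]; simp [isHomogeneous_zero]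

lemma lap_add {n : ℕ} (p q : MvPolynomial (Fin n) ℂ) : lap n (p + q) = lap n p + lap n q := by
  simp [lap, Finset.sum_add_distrib]

lemma lap_sum {n : ℕ} {ι : Type*} (s : Finset ι) (p : ι → MvPolynomial (Fin n) ℂ) :
    lap n (∑ i ∈ s, p i) = ∑ i ∈ s, lap n (p i) := by
  simp only [lap, map_sum]; rw [Finset.sum_comm]

lemma lap_C_mul {n : ℕ} (c : ℂ) (p : MvPolynomial (Fin n) ℂ) :
    lap n (C c * p) = C c * lap n p := by
  simp only [lap, pderiv_C_mul, Finset.mul_sum]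

lemma lap_mul {n : ℕ} (p q : MvPolynomial (Fin n) ℂ) :
    lap n (p * q) = lap n p * q + 2 * ∑ i, pderiv i p * pderiv i q + p * lap n q := by
  simp only [lap, pderiv_mul, map_add, Finset.sum_mul, Finset.mul_sum, ← Finset.sum_add_distrib]
  refine Finset.sum_congr rfl fun i _ => by ring

lemma lap_lin_pow {n : ℕ} {θ : En n} (hθ : ‖θ‖ = 1) (a : ℕ) :
    lap n (lin θ ^ a) = C ((a : ℂ) * (a - 1)) * lin θ ^ (a - 2) := by
  rcases a with _ | _ | a
  · simp [lap]
  · simp [lap, pderiv_lin]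
  have h : ∑ i, (C (θ i : ℂ) : MvPolynomial (Fin n) ℂ) ^ 2 = 1 := by
    have : ∑ i, ((θ i : ℂ)) ^ 2 = 1 := by
      have := EuclideanSpace.norm_sq_eq θ
      rw [hθ] at this
      simp only [Real.norm_eq_abs, sq_abs, one_pow] at this
      exact_mod_cast this.symm
    simp_rw [← C_pow, ← map_sum, this, map_one]
  simp only [lap, pderiv_pow, pderiv_lin, pderiv_mul, pderiv_C]
  rw [← mul_one (C _ * _), ← h, Finset.mul_sum]
  refine Finset.sum_congr rfl fun i _ => ?_
  have e : (C (((a + 1 + 1 : ℕ) : ℂ) * (((a + 1 + 1 : ℕ) : ℂ) - 1)) : MvPolynomial (Fin n) ℂ) = ((a : MvPolynomial (Fin n) ℂ) + 2) * (a + 1) := by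
    have : (((a + 1 + 1 : ℕ) : ℂ) * (((a + 1 + 1 : ℕ) : ℂ) - 1)) = (((a + 2) * (a + 1) : ℕ) : ℂ) := by
      push_cast; ring
    rw [this, map_natCast]; push_cast; ring
  rw [e]
  have hd : pderiv i (((a + 1 + 1 : ℕ) : MvPolynomial (Fin n) ℂ)) = 0 := by
    rw [← map_natCast (C : ℂ →+* MvPolynomial (Fin n) ℂ), pderiv_C]
  simp only [hd, Nat.add_sub_cancel, show a + 1 + 1 - 2 = a by omega]
  push_cast; ring

lemma lap_nsq_pow {n : ℕ} (j : ℕ) :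
    lap n (nsq n ^ j) = C (2 * (j : ℂ) * (2 * j - 2 + n)) * nsq n ^ (j - 1) := by
  rcases j with _ | j
  · simp [lap]
  have e : (C (2 * ((j + 1 : ℕ) : ℂ) * (2 * ((j + 1 : ℕ) : ℂ) - 2 + n)) : MvPolynomial (Fin n) ℂ)
      = 2 * ((j : MvPolynomial (Fin n) ℂ) + 1) * (2 * j + n) := by
    have : 2 * ((j + 1 : ℕ) : ℂ) * (2 * ((j + 1 : ℕ) : ℂ) - 2 + n) = ((2 * (j + 1) * (2 * j + n) : ℕ) : ℂ) := by
      push_cast; ring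
    rw [this, map_natCast]; push_cast; ring
  rw [e]
  have hd : ∀ i, pderiv i (((j + 1 : ℕ) : MvPolynomial (Fin n) ℂ)) = 0 := by
    intro i; rw [← map_natCast (C : ℂ →+* MvPolynomial (Fin n) ℂ), pderiv_C]
  have hd2 : ∀ i, pderiv i ((2 : MvPolynomial (Fin n) ℂ)) = 0 := by
    intro i; rw [← map_ofNat (C : ℂ →+* MvPolynomial (Fin n) ℂ) 2, pderiv_C]
  simp only [lap, pderiv_pow, pderiv_nsq, pderiv_mul, hd, hd2, pderiv_X_self, Nat.add_sub_cancel]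
  have e3 : ∀ i : Fin n, (0 * nsq n ^ j + ((j + 1 : ℕ) : MvPolynomial (Fin n) ℂ) * ((j : MvPolynomial (Fin n) ℂ) * nsq n ^ (j - 1) * (2 * X i))) * (2 * X i) +
      ((j + 1 : ℕ) : MvPolynomial (Fin n) ℂ) * nsq n ^ j * (0 * X i + 2 * 1) =
      4 * ((j : MvPolynomial (Fin n) ℂ) + 1) * (j : MvPolynomial (Fin n) ℂ) * nsq n ^ (j - 1) * (X i) ^ 2 + 2 * ((j : MvPolynomial (Fin n) ℂ) + 1) * nsq n ^ j := by
    intro i; push_cast; ring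
  simp only [e3, Finset.sum_add_distrib, ← Finset.mul_sum]
  change _ * nsq n + _ = _
  simp only [Finset.sum_const, Finset.card_univ, Fintype.card_fin, nsmul_eq_mul]
  rcases j with _ | j
  · simp
  · rw [Nat.add_sub_cancel, pow_succ]; push_cast; ring

lemma lap_mon {n : ℕ} {θ : En n} (hθ : ‖θ‖ = 1) (a j : ℕ) :
    lap n (lin θ ^ a * nsq n ^ j) = C ((a : ℂ) * (a - 1)) * (lin θ ^ (a - 2) * nsq n ^ j) +
      C (2 * (j : ℂ) * (2 * j - 2 + n + 2 * a)) * (lin θ ^ a * nsq n ^ (j - 1)) := by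
  have hc : ∑ i, pderiv i (lin θ ^ a) * pderiv i (nsq n ^ j) =
      C (2 * (a : ℂ) * j) * (lin θ ^ a * nsq n ^ (j - 1)) := by
    simp only [pderiv_pow, pderiv_lin, pderiv_nsq]
    have e : ∀ i : Fin n, (a : MvPolynomial (Fin n) ℂ) * lin θ ^ (a - 1) * C (θ i : ℂ) *
        ((j : MvPolynomial (Fin n) ℂ) * nsq n ^ (j - 1) * (2 * X i)) = (2 * (a : MvPolynomial (Fin n) ℂ) * (j : MvPolynomial (Fin n) ℂ) * lin θ ^ (a - 1) * nsq n ^ (j - 1)) *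
          (C (θ i : ℂ) * X i) := by intro i; ring
    simp only [e, ← Finset.mul_sum]
    change _ * lin θ = _
    rcases a with _ | a
    · simp
    · simp only [map_mul, map_natCast, map_ofNat, Nat.add_sub_cancel, pow_succ]; ring
  rw [lap_mul, hc, lap_lin_pow hθ, lap_nsq_pow]
  simp only [map_mul, map_add, map_sub, map_natCast, map_ofNat]
  ring

lemma aux {n : ℕ} {a b c d : ℂ} {m : MvPolynomial (Fin n) ℂ} (h : a * b = -(c * d)) :
    C a * (C b * m) = -(C c * (C d * m)) := by
  rw [← mul_assoc, ← C_mul, h, C_neg, C_mul]; ring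

lemma bq_rec {l : ℝ} (i j : ℕ) :
    bq l (i + 2 * j + 2) j * ((i + 2) * (i + 1)) +
      bq l (i + 2 * j + 2) (j + 1) * (2 * (j + 1) * (2 * (j + 1) - 2 + 2 * l + 2 * i)) = 0 := by
  rw [bq_pos (by omega) (by omega), bq_pos (by omega) (by omega)]
  rw [show i + 2 * j + 2 - 2 * j = i + 1 + 1 by omega, show i + 2 * j + 2 - 2 * (j + 1) = i by omega,
    show i + 2 * j + 2 - j - 1 = (i + j) + 1 by omega, show i + 2 * j + 2 - (j + 1) - 1 = i + j by omega,
    pz_succ, Nat.factorial_succ (i + 1), Nat.factorial_succ i, Nat.factorial_succ j]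
  have h1 : (i.factorial : ℝ) ≠ 0 := by exact_mod_cast i.factorial_ne_zero
  have h2 : (j.factorial : ℝ) ≠ 0 := by exact_mod_cast j.factorial_ne_zero
  push_cast
  field_simp
  ring

lemma Qp_harm {n : ℕ} (hn : 2 ≤ n) {θ : En n} (hθ : ‖θ‖ = 1) (k : ℕ) :
    IsHarmonicPoly n (Qp θ k) := by
  unfold IsHarmonicPoly
  let β : ℕ → MvPolynomial (Fin n) ℂ := fun j =>
    C ((bq (n / 2) k j : ℝ) : ℂ) * (C (2 * (j : ℂ) * (2 * j - 2 + n + 2 * (k - 2 * j : ℕ))) *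
      (lin θ ^ (k - 2 * j) * nsq n ^ (j - 1)))
  have hl : (0 : ℝ) < n / 2 := by
    have : (0 : ℝ) < n := by exact_mod_cast (by omega : 0 < n)
    positivity
  have key : ∀ j, lap n (C ((bq (n / 2) k j : ℝ) : ℂ) * (lin θ ^ (k - 2 * j) * nsq n ^ j)) =
      β j - β (j + 1) := by
    intro j
    rw [lap_C_mul, lap_mon hθ, mul_add]
    have : C ((bq (n / 2) k j : ℝ) : ℂ) * (C (((k - 2 * j : ℕ) : ℂ) * ((k - 2 * j : ℕ) - 1)) *
        (lin θ ^ (k - 2 * j - 2) * nsq n ^ j)) = - β (j + 1) := by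
      by_cases h : 2 * j + 2 ≤ k
      · obtain ⟨i, rfl⟩ : ∃ i, k = i + 2 * j + 2 := ⟨k - (2 * j + 2), by omega⟩
        have h1 := bq_rec (l := n / 2) i j
        simp only [β]
        rw [show i + 2 * j + 2 - 2 * j = i + 2 by omega, show i + 2 * j + 2 - 2 * (j + 1) = i by omega,
          Nat.add_sub_cancel, Nat.add_sub_cancel]
        apply aux
        have h2 := congrArg (fun r : ℝ => (r : ℂ)) h1
        push_cast at h2 ⊢
        linear_combination h2
      · have h1 : β (j + 1) = 0 := by
          simp only [β]; rw [bq_big (by omega)]; simp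
        rw [h1]
        by_cases h2 : 2 * j ≤ k
        · have : k - 2 * j = 0 ∨ k - 2 * j = 1 := by omega
          rcases this with h3 | h3 <;> simp [h3]
        · rw [bq_big (by omega)]; simp
    rw [this]
    simp only [β]; ring
  rw [Qp, lap_sum]
  simp only [key]
  rw [Finset.sum_range_sub']
  have h0 : β 0 = 0 := by simp [β]
  have h1 : β (k + 1) = 0 := by simp only [β]; rw [bq_big (by omega)]; simp
  rw [h0, h1, sub_zero]

lemma integrable_sphere {n : ℕ} (p : MvPolynomial (Fin n) ℂ) :
    Integrable (fun η : sphere (0 : En n) 1 => evalR p (η : En n)) (sphereMeasure n) := by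
  have : IsFiniteMeasure (sphereMeasure n) := by unfold sphereMeasure; infer_instance
  exact ((continuous_evalR p).comp continuous_subtype_val).integrable_of_hasCompactSupport
    (HasCompactSupport.of_compactSpace _)

lemma bq_zero {n : ℕ} (k : ℕ) :
    ((bq (n / 2) k 0 : ℝ) : ℂ) = (∏ l ∈ Finset.range k, ((n : ℂ) + 2 * l)) / k.factorial := by
  have h : ∀ m, (2 : ℝ) ^ m * pz (n / 2) m = ∏ l ∈ Finset.range m, ((n : ℝ) + 2 * l) := by
    intro m
    induction m with
    | zero => simp [pz]
    | succ m ih => rw [pz_succ, Finset.prod_range_succ, ← ih]; ring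
  have : bq (n / 2) k 0 = (∏ l ∈ Finset.range k, ((n : ℝ) + 2 * l)) / k.factorial := by
    rw [← h]
    rcases k with _ | k
    · simp [bq, pz]
    · unfold bq
      rw [if_neg (by omega), if_pos (by omega)]
      simp only [Nat.mul_zero, Nat.sub_zero, Nat.add_sub_cancel, pz_succ]
      simp; ring
  rw [this]; push_cast; rfl

lemma Qp_repr {n : ℕ} (hn : 2 ≤ n) (θ : En n) {k : ℕ}
    {H : MvPolynomial (Fin n) ℂ} (hH : H.IsHomogeneous k) (h : IsHarmonicPoly n H) :
    ∫ η : sphere (0 : En n) 1, evalR (Qp θ k) (η : En n) * evalR H (η : En n) ∂(sphereMeasure n)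
      = omegaN n * evalR H θ := by
  have e : ∀ η : En n, evalR (Qp θ k) η * evalR H η = ∑ j ∈ Finset.range (k + 1),
      ((bq (n / 2) k j : ℝ) : ℂ) * evalR (lin θ ^ (k - 2 * j) * nsq n ^ j * H) η := by
    intro η
    simp only [Qp, evalR_sum, evalR_mul, evalR_C, Finset.sum_mul]
    refine Finset.sum_congr rfl fun i _ => by ring
  simp only [e]
  rw [integral_finsetSum _ fun j _ => (integrable_sphere _).const_mul _]
  simp only [integral_const_mul]
  rw [Finset.sum_range_succ', Finset.sum_eq_zero, zero_add, ← sphere_int_top hn θ hH h, bq_zero]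
  · simp
  · intro j _
    by_cases hj : 2 * (j + 1) ≤ k
    · rw [sphere_int_low hn θ (by omega) hj hH h, mul_zero]
    · rw [bq_big (by omega)]; simp

end RestAux

namespace RestAux

lemma evalR_conj {n : ℕ} (p : MvPolynomial (Fin n) ℂ) (x : En n) :
    evalR (map (starRingEnd ℂ) p) x = (starRingEnd ℂ) (evalR p x) := by
  induction p using MvPolynomial.induction_on with
  | C a => simp [evalR]
  | add p q hp hq => rw [map_add, evalR_add, hp, hq, evalR_add, map_add]
  | mul_X p j hp =>
    rw [map_mul, evalR_mul, hp, map_X, evalR_mul, map_mul, evalR_X, Complex.conj_ofReal]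

lemma harm_conj {n : ℕ} {p : MvPolynomial (Fin n) ℂ} (h : IsHarmonicPoly n p) :
    IsHarmonicPoly n (map (starRingEnd ℂ) p) := by
  unfold IsHarmonicPoly lap at *
  simp only [pderiv_map]
  rw [← map_sum, h, map_zero]

lemma kernel {n : ℕ} (hn : 2 ≤ n) {N k : ℕ} (Y : Fin N → MvPolynomial (Fin n) ℂ)
    (hYhom : ∀ m, (Y m).IsHomogeneous k)
    (hYharm : ∀ m, IsHarmonicPoly n (Y m))
    (hYon : ∀ (m m' : Fin N),
      ∫ θ : sphere (0 : En n) 1, evalR (Y m) (θ : En n) *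
        (starRingEnd ℂ) (evalR (Y m') (θ : En n)) ∂(sphereMeasure n)
      = if m = m' then 1 else 0)
    (hYbasis : ∀ (Q : MvPolynomial (Fin n) ℂ), Q.IsHomogeneous k →
      IsHarmonicPoly n Q → ∃ c : Fin N → ℂ, Q = ∑ m, c m • Y m)
    {θ : En n} (hθ : ‖θ‖ = 1) (x : En n) :
    ∑ m, evalR (Y m) θ * (starRingEnd ℂ) (evalR (Y m) x) =
      ((Qr (n / 2) (inner ℝ θ x) (‖x‖ ^ 2) k / omegaN n : ℝ) : ℂ) := by
  obtain ⟨c, hc⟩ := hYbasis (Qp θ k) (Qp_hom θ k) (Qp_harm hn hθ k)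
  have hcm : ∀ m, c m = omegaN n * (starRingEnd ℂ) (evalR (Y m) θ) := by
    intro m
    have h1 := Qp_repr hn θ ((hYhom m).map (starRingEnd ℂ)) (harm_conj (hYharm m))
    rw [evalR_conj] at h1
    rw [← h1, hc]
    have e : ∀ η : En n, evalR (∑ m, c m • Y m) η * evalR (map (starRingEnd ℂ) (Y m)) η =
        ∑ m', c m' * evalR (Y m' * map (starRingEnd ℂ) (Y m)) η := by
      intro η
      simp only [evalR_sum, evalR_smul, evalR_mul, Finset.sum_mul]
      refine Finset.sum_congr rfl fun i _ => by ring
    simp only [e]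
    rw [integral_finsetSum _ fun j _ => (integrable_sphere _).const_mul _]
    simp only [integral_const_mul, evalR_mul, evalR_conj, hYon]
    simp
  have h2 := congrArg (fun p => evalR p x) hc
  simp only [evalR_Qp, evalR_sum, evalR_smul, hcm] at h2
  have h3 := congrArg (starRingEnd ℂ) h2
  simp only [map_sum, map_mul, Complex.conj_ofReal, Complex.conj_conj, mul_assoc, ← Finset.mul_sum] at h3
  have h4 : (omegaN n : ℂ) ≠ 0 := by exact_mod_cast (omegaN_pos hn).ne'
  rw [Complex.ofReal_div, h3]
  field_simp

/-- Gegenbauer coefficients. -/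
def cf (l : ℝ) (k j : ℕ) : ℝ :=
  if 2 * j ≤ k then (-1) ^ j * 2 ^ (k - 2 * j) * pz l (k - j) /
    (j.factorial * (k - 2 * j).factorial) else 0

lemma cf_pos {l : ℝ} {k j : ℕ} (h : 2 * j ≤ k) : cf l k j =
    (-1) ^ j * 2 ^ (k - 2 * j) * pz l (k - j) / (j.factorial * (k - 2 * j).factorial) := by
  unfold cf; rw [if_pos h]

lemma cf_big {l : ℝ} {k j : ℕ} (h : k < 2 * j) : cf l k j = 0 := by
  unfold cf; rw [if_neg (by omega)]

/-- A Gegenbauer polynomial, as a function of `s` and `q`. -/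
def Cr (l s q : ℝ) (k : ℕ) : ℝ := ∑ j ∈ Finset.range (k + 1), cf l k j * (s ^ (k - 2 * j) * q ^ j)

lemma Cr_ext (l s q : ℝ) {k M : ℕ} (h : k + 1 ≤ M) :
    Cr l s q k = ∑ j ∈ Finset.range M, cf l k j * (s ^ (k - 2 * j) * q ^ j) := by
  unfold Cr
  refine Finset.sum_subset (by simpa using h) fun j _ hj => ?_
  rw [Finset.mem_range, not_lt] at hj
  rw [cf_big (by omega), zero_mul]

lemma Cr_term (l s q : ℝ) (k j : ℕ) :
    (k + 2) * (cf l (k + 2) (j + 1) * (s ^ (k + 2 - 2 * (j + 1)) * q ^ (j + 1))) =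
    2 * s * (k + 1 + l) * (cf l (k + 1) (j + 1) * (s ^ (k + 1 - 2 * (j + 1)) * q ^ (j + 1))) -
    q * (k + 2 * l) * (cf l k j * (s ^ (k - 2 * j) * q ^ j)) := by
  have h2 : (j.factorial : ℝ) ≠ 0 := by exact_mod_cast j.factorial_ne_zero
  rcases lt_trichotomy (2 * j) k with h | h | h
  · obtain ⟨i, rfl⟩ : ∃ i, k = i + 2 * j + 1 := ⟨k - (2 * j + 1), by omega⟩
    have h1 : (i.factorial : ℝ) ≠ 0 := by exact_mod_cast i.factorial_ne_zero
    rw [cf_pos (by omega), cf_pos (by omega), cf_pos (by omega)]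
    rw [show i + 2 * j + 1 + 2 - 2 * (j + 1) = i + 1 by omega,
      show i + 2 * j + 1 + 1 - 2 * (j + 1) = i by omega,
      show i + 2 * j + 1 - 2 * j = i + 1 by omega,
      show i + 2 * j + 1 + 2 - (j + 1) = (i + j + 1) + 1 by omega,
      show i + 2 * j + 1 + 1 - (j + 1) = i + j + 1 by omega,
      show i + 2 * j + 1 - j = i + j + 1 by omega, pz_succ l (i + j + 1), Nat.factorial_succ i,
      Nat.factorial_succ j]
    push_cast
    field_simp
    ring
  · subst h
    rw [cf_pos (by omega), cf_big (k := 2 * j + 1) (by omega), cf_pos (by omega)]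
    rw [show 2 * j + 2 - 2 * (j + 1) = 0 by omega, show 2 * j + 2 - (j + 1) = j + 1 by omega,
      show 2 * j - 2 * j = 0 by omega, show 2 * j - j = j by omega, pz_succ, Nat.factorial_succ j]
    push_cast
    field_simp
    ring
  · rw [cf_big (by omega), cf_big (by omega), cf_big (by omega)]; ring

lemma Cr_term0 (l s q : ℝ) (k : ℕ) :
    (k + 2) * (cf l (k + 2) 0 * (s ^ (k + 2 - 2 * 0) * q ^ 0)) =
    2 * s * (k + 1 + l) * (cf l (k + 1) 0 * (s ^ (k + 1 - 2 * 0) * q ^ 0)) := by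
  have h2 : (k.factorial : ℝ) ≠ 0 := by exact_mod_cast k.factorial_ne_zero
  rw [cf_pos (by omega), cf_pos (by omega)]
  simp only [Nat.mul_zero, Nat.sub_zero, pz_succ l (k + 1), Nat.factorial_succ (k + 1),
    Nat.factorial_succ k, Nat.factorial_zero]
  push_cast
  field_simp
  ring

lemma Cr_rec (l s q : ℝ) (k : ℕ) :
    (k + 2) * Cr l s q (k + 2) = 2 * s * (k + 1 + l) * Cr l s q (k + 1) - q * (k + 2 * l) * Cr l s q k := by
  rw [Cr_ext l s q (k := k + 2) (M := k + 3 + 1) (by omega), Cr_ext l s q (k := k + 1) (M := k + 3 + 1) (by omega),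
    Cr_ext l s q (k := k) (M := k + 3) (by omega), Finset.sum_range_succ', Finset.sum_range_succ' _ (k + 3),
    mul_add, mul_add, Cr_term0, Finset.mul_sum, Finset.mul_sum, Finset.mul_sum]
  simp only [Cr_term, Finset.sum_sub_distrib]
  ring

lemma bq_cf (l : ℝ) (k j : ℕ) : bq l (k + 2) (j + 1) = cf l (k + 2) (j + 1) - cf l k j := by
  by_cases h : 2 * j ≤ k
  · obtain ⟨i, rfl⟩ : ∃ i, k = i + 2 * j := ⟨k - (2 * j), by omega⟩
    rw [bq_pos (by omega) (by omega), cf_pos (by omega), cf_pos (by omega)]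
    rw [show i + 2 * j + 2 - 2 * (j + 1) = i by omega, show i + 2 * j + 2 - (j + 1) - 1 = i + j by omega,
      show i + 2 * j + 2 - (j + 1) = i + j + 1 by omega, show i + 2 * j - 2 * j = i by omega,
      show i + 2 * j - j = i + j by omega, pz_succ, Nat.factorial_succ j]
    have h1 : (i.factorial : ℝ) ≠ 0 := by exact_mod_cast i.factorial_ne_zero
    have h2 : (j.factorial : ℝ) ≠ 0 := by exact_mod_cast j.factorial_ne_zero
    push_cast
    field_simp
    ring
  · rw [bq_big (by omega), cf_big (by omega), cf_big (by omega)]; ring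

lemma bq_cf0 (l : ℝ) (k : ℕ) : bq l k 0 = cf l k 0 := by
  rcases k with _ | k
  · simp [bq, cf, pz]
  · rw [bq_pos (by omega) (by omega), cf_pos (by omega)]
    simp only [Nat.mul_zero, Nat.sub_zero, Nat.add_sub_cancel, pz_succ]
    push_cast; ring

lemma Qr_Cr (l s q : ℝ) (k : ℕ) : Qr l s q (k + 2) = Cr l s q (k + 2) - q * Cr l s q k := by
  rw [Cr_ext l s q (k := k) (M := k + 2) (by omega), Cr, Qr, Finset.sum_range_succ',
    Finset.sum_range_succ' _ (k + 2), bq_cf0]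
  simp only [bq_cf, sub_mul, Finset.sum_sub_distrib, Finset.mul_sum]
  have : ∀ j, cf l k j * (s ^ (k + 2 - 2 * (j + 1)) * q ^ (j + 1)) =
      q * (cf l k j * (s ^ (k - 2 * j) * q ^ j)) := by
    intro j
    rw [show k + 2 - 2 * (j + 1) = k - 2 * j by omega]; ring
  simp only [this]
  ring

lemma Qr_zero (l s q : ℝ) : Qr l s q 0 = Cr l s q 0 := by
  simp [Qr, Cr, bq_cf0]

lemma Qr_one (l s q : ℝ) : Qr l s q 1 = Cr l s q 1 := by
  simp [Qr, Cr, Finset.sum_range_succ, bq_cf0]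
  left
  rw [bq_big (by omega), cf_big (by omega)]

lemma Cr_zero (l s q : ℝ) : Cr l s q 0 = 1 := by simp [Cr, cf, pz]
lemma Cr_one (l s q : ℝ) : Cr l s q 1 = 2 * l * s := by
  simp [Cr, cf, pz, Finset.sum_range_succ]

/-- binomial coefficient -/
def pb (l : ℂ) (i : ℕ) : ℂ := Ring.choose (l + i - 1) i

lemma pb_zero (l : ℂ) : pb l 0 = 1 := by simp [pb]

lemma pb_succ (l : ℂ) (i : ℕ) : (i + 1) * pb l (i + 1) = (l + i) * pb l i := by
  have h : ∀ i : ℕ, (i.factorial : ℂ) * pb l i = ∏ m ∈ Finset.range i, (l + m) := by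
    intro i
    have e := Ring.factorial_nsmul_multichoose_eq_ascPochhammer l i
    rw [Ring.multichoose_eq, nsmul_eq_mul, Polynomial.ascPochhammer_smeval_eq_eval] at e
    rw [pb, e]
    clear e
    induction i with
    | zero => simp
    | succ i ih => rw [ascPochhammer_succ_eval, Finset.prod_range_succ, ih]
  have h1 := h i
  have h2 := h (i + 1)
  rw [Finset.prod_range_succ, ← h1, Nat.factorial_succ] at h2
  have h3 : (i.factorial : ℂ) ≠ 0 := by exact_mod_cast i.factorial_ne_zero
  apply mul_left_cancel₀ h3
  push_cast at h2
  linear_combination h2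

/-- Cauchy product coefficients -/
def Dc (l u v : ℂ) (k : ℕ) : ℂ :=
  ∑ p ∈ Finset.HasAntidiagonal.antidiagonal k, (pb l p.1 * u ^ p.1) * (pb l p.2 * v ^ p.2)

lemma ps_ode (l u : ℂ) : PowerSeries.derivative ℂ (PowerSeries.mk fun i => pb l i * u ^ i) *
    (1 - PowerSeries.C u * PowerSeries.X) =
    PowerSeries.C (l * u) * (PowerSeries.mk fun i => pb l i * u ^ i) := by
  ext k
  rw [mul_sub, mul_one, mul_left_comm, map_sub, PowerSeries.coeff_C_mul, PowerSeries.coeff_C_mul,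
    PowerSeries.coeff_derivative, PowerSeries.coeff_mk]
  rcases k with _ | k
  · have := pb_succ l 0
    simp at this ⊢
    rw [this]; ring
  · have := pb_succ l (k + 1)
    rw [PowerSeries.coeff_succ_mul_X, PowerSeries.coeff_derivative, PowerSeries.coeff_mk]
    push_cast at this ⊢
    linear_combination u ^ (k + 2) * this

lemma Dc_rec (l u v : ℂ) (k : ℕ) :
    (k + 2) * Dc l u v (k + 2) = (u + v) * (k + 1 + l) * Dc l u v (k + 1)
      - (u * v) * (k + 2 * l) * Dc l u v k := by
  set A := (PowerSeries.mk fun i => pb l i * u ^ i) with hA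
  set B := (PowerSeries.mk fun i => pb l i * v ^ i) with hB
  have hD : ∀ k, Dc l u v k = PowerSeries.coeff k (A * B) := by
    intro k
    simp [Dc, PowerSeries.coeff_mul, hA, hB]
  have h1 := ps_ode l u
  have h2 := ps_ode l v
  rw [← hA] at h1
  rw [← hB] at h2
  have h3 : PowerSeries.derivative ℂ (A * B) = A * PowerSeries.derivative ℂ B + B * PowerSeries.derivative ℂ A := by
    simpa [smul_eq_mul] using Derivation.leibniz (PowerSeries.derivative ℂ) A B
  have h4 : PowerSeries.derivative ℂ (A * B) - PowerSeries.C (u + v) * (PowerSeries.X * PowerSeries.derivative ℂ (A * B)) +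
      PowerSeries.C (u * v) * (PowerSeries.X * (PowerSeries.X * PowerSeries.derivative ℂ (A * B))) =
      PowerSeries.C (l * (u + v)) * (A * B) - PowerSeries.C (2 * l * (u * v)) * (PowerSeries.X * (A * B)) := by
    rw [h3]
    simp only [map_mul, map_add, map_ofNat] at *
    linear_combination (1 - PowerSeries.C v * PowerSeries.X) * B * h1 + (1 - PowerSeries.C u * PowerSeries.X) * A * h2
  have h5 := congrArg (PowerSeries.coeff (k + 1)) h4
  simp only [LinearMap.map_sub, LinearMap.map_add, PowerSeries.coeff_C_mul, PowerSeries.coeff_succ_X_mul,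
    PowerSeries.coeff_derivative, ← hD] at h5
  have h6 : PowerSeries.coeff k (PowerSeries.X * PowerSeries.derivative ℂ (A * B)) = k * Dc l u v k := by
    rcases k with _ | k
    · simp
    · rw [PowerSeries.coeff_succ_X_mul, PowerSeries.coeff_derivative, hD]; push_cast; ring
  rw [h6] at h5
  push_cast at h5
  linear_combination h5

lemma Dc_eq (l s q : ℝ) (u v : ℂ) (h1 : u + v = 2 * s) (h2 : u * v = q) (k : ℕ) :
    Dc l u v k = ((Cr l s q k : ℝ) : ℂ) := by
  induction k using Nat.strong_induction_on with
  | _ k ih =>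
  rcases k with _ | _ | k
  · simp [Dc, pb_zero, Cr_zero]
  · have := pb_succ l 0
    simp [pb_zero] at this
    simp [Dc, pb_zero, Cr_one, Finset.Nat.antidiagonal_succ, this]
    linear_combination (l : ℂ) * h1
  · have h3 := Dc_rec l u v k
    have h4 := congrArg (fun r : ℝ => (r : ℂ)) (Cr_rec l s q k)
    push_cast at h4
    rw [ih (k + 1) (by omega), ih k (by omega), h1, h2, ← h4] at h3
    have h5 : (k : ℂ) + 2 ≠ 0 := by exact_mod_cast (by omega : k + 2 ≠ 0)
    exact mul_left_cancel₀ h5 h3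

end RestAux

namespace RestAux

lemma gen1 (l : ℂ) {z : ℂ} (hz : ‖z‖ < 1) :
    HasSum (fun i => pb l i * z ^ i) (1 / (1 - z) ^ l) := by
  have h := Complex.one_div_one_sub_cpow_hasFPowerSeriesOnBall_zero l
  have hz' : z ∈ Metric.eball (0 : ℂ) 1 := by
    rw [Metric.mem_eball, edist_zero_right, ← ofReal_norm]
    rw [← ENNReal.ofReal_one]
    exact (ENNReal.ofReal_lt_ofReal_iff one_pos).2 hz
  have h2 := h.hasSum hz'
  simpa [FormalMultilinearSeries.ofScalars_apply_eq, pb, zero_add, mul_comm] using h2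

lemma cpow_mul_of_re {a b : ℂ} (ha : 0 < a.re) (hb : 0 < b.re) (l : ℂ) :
    (a * b) ^ l = a ^ l * b ^ l := by
  have ha0 : a ≠ 0 := by rintro rfl; simp at ha
  have hb0 : b ≠ 0 := by rintro rfl; simp at hb
  have h1 := abs_lt.1 (Complex.abs_arg_lt_pi_div_two_iff.2 (Or.inl ha))
  have h2 := abs_lt.1 (Complex.abs_arg_lt_pi_div_two_iff.2 (Or.inl hb))
  have h3 := (Complex.log_mul_eq_add_log_iff ha0 hb0).2
    ⟨by linarith [h1.1, h2.1], by linarith [h1.2, h2.2]⟩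
  rw [Complex.cpow_def_of_ne_zero (mul_ne_zero ha0 hb0), Complex.cpow_def_of_ne_zero ha0,
    Complex.cpow_def_of_ne_zero hb0, h3, ← Complex.exp_add, add_mul]

lemma re_pos {z : ℂ} (hz : ‖z‖ < 1) : 0 < (1 - z).re := by
  have := (Complex.abs_re_le_norm z).trans_lt hz
  simp; linarith [(abs_lt.1 this).2]

lemma gen2 (l : ℝ) {s q : ℝ} (hsq : s ^ 2 ≤ q) {w : ℂ} (hw : Real.sqrt q * ‖w‖ < 1) :
    HasSum (fun k => (Cr l s q k : ℂ) * w ^ k) (1 / (1 - 2 * s * w + q * w ^ 2) ^ (l : ℂ)) := by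
  set u : ℂ := ⟨s, Real.sqrt (q - s ^ 2)⟩ with hu
  set v : ℂ := ⟨s, -Real.sqrt (q - s ^ 2)⟩ with hv
  have hs : Real.sqrt (q - s ^ 2) * Real.sqrt (q - s ^ 2) = q - s ^ 2 :=
    Real.mul_self_sqrt (by linarith)
  have h1 : u + v = 2 * s := by apply Complex.ext <;> simp [hu, hv]; ring
  have h2 : u * v = q := by
    apply Complex.ext <;> simp [hu, hv]
    · linear_combination hs
    · ring
  have nu : ‖u‖ = Real.sqrt q := by
    rw [Complex.norm_def]; congr 1; rw [Complex.normSq_mk]; linear_combination hs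
  have nv : ‖v‖ = Real.sqrt q := by
    rw [Complex.norm_def]; congr 1; rw [Complex.normSq_mk]; linear_combination hs
  have au : ‖u * w‖ < 1 := by rwa [norm_mul, nu]
  have av : ‖v * w‖ < 1 := by rwa [norm_mul, nv]
  have su := gen1 l au
  have sv := gen1 l av
  have t1 := summable_norm_sum_mul_antidiagonal_of_summable_norm su.summable.norm sv.summable.norm
  have t2 := tsum_mul_tsum_eq_tsum_sum_antidiagonal_of_summable_norm su.summable.norm sv.summable.norm
  have e : ∀ k, (∑ kl ∈ Finset.HasAntidiagonal.antidiagonal k,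
      pb l kl.1 * (u * w) ^ kl.1 * (pb l kl.2 * (v * w) ^ kl.2)) = (Cr l s q k : ℂ) * w ^ k := by
    intro k
    rw [← Dc_eq l s q u v h1 h2, Dc, Finset.sum_mul]
    refine Finset.sum_congr rfl fun p hp => ?_
    rw [Finset.HasAntidiagonal.mem_antidiagonal] at hp
    rw [← hp, mul_pow, mul_pow, pow_add]; ring
  simp only [e] at t1 t2
  rw [su.tsum_eq, sv.tsum_eq, div_mul_div_comm, one_mul, ← cpow_mul_of_re (re_pos au) (re_pos av)] at t2
  have e3 : (1 - u * w) * (1 - v * w) = 1 - 2 * s * w + q * w ^ 2 := by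
    rw [← h1, ← h2]; ring
  rw [e3] at t2
  rw [t2]
  exact t1.of_norm.hasSum

lemma gen3 (l : ℝ) {s q : ℝ} (hsq : s ^ 2 ≤ q) {w : ℂ} (hw : Real.sqrt q * ‖w‖ < 1) :
    HasSum (fun k => (Qr l s q k : ℂ) * w ^ k)
      ((1 - q * w ^ 2) * (1 / (1 - 2 * s * w + q * w ^ 2) ^ (l : ℂ))) := by
  have h := gen2 l hsq hw
  have h1 : HasSum (fun k => if k < 2 then (0 : ℂ) else q * w ^ 2 * (Cr l s q (k - 2) * w ^ (k - 2)))
      (q * w ^ 2 * (1 / (1 - 2 * s * w + q * w ^ 2) ^ (l : ℂ))) := by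
    rw [← hasSum_nat_add_iff' 2]
    simpa [Finset.sum_range_succ] using h.mul_left (q * w ^ 2)
  have h2 := h.sub h1
  rw [sub_mul, one_mul]
  have e : (fun k => (Qr l s q k : ℂ) * w ^ k) = fun k => (Cr l s q k : ℂ) * w ^ k -
      if k < 2 then (0 : ℂ) else q * w ^ 2 * (Cr l s q (k - 2) * w ^ (k - 2)) := by
    funext k
    rcases k with _ | _ | k
    · simp [Qr_zero]
    · simp [Qr_one]
    · simp [Qr_Cr]; ring
  rw [e]
  exact h2

lemma interch {ι α : Type*} [Countable ι] [MeasurableSpace α] (ν : Measure α) [IsFiniteMeasure ν]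
    (F : ι → α → ℂ) (G : α → ℂ) (M : ℝ) (hm : ∀ i, AEStronglyMeasurable (F i) ν)
    (hb : ∀ᵐ x ∂ν, ∀ S : Finset ι, ∑ i ∈ S, ‖F i x‖ ≤ M)
    (hs : ∀ᵐ x ∂ν, HasSum (fun i => F i x) (G x)) :
    HasSum (fun i => ∫ x, F i x ∂ν) (∫ x, G x ∂ν) := by
  have hi : ∀ i, Integrable (F i) ν := by
    intro i
    refine Integrable.of_bound (hm i) M ?_
    filter_upwards [hb] with x hx
    simpa using hx {i}
  have h := hasSum_integral_of_summable_integral_norm hi ?_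
  · have e : ∫ x, ∑' i, F i x ∂ν = ∫ x, G x ∂ν := by
      refine integral_congr_ae ?_
      filter_upwards [hs] with x hx
      exact hx.tsum_eq
    rwa [e] at h
  · refine summable_of_sum_le (c := ∫ _, M ∂ν) (fun i => integral_nonneg fun x => norm_nonneg _) fun S => ?_
    rw [← integral_finsetSum _ fun i _ => (hi i).norm]
    refine integral_mono_ae (integrable_finsetSum _ fun i _ => (hi i).norm) (integrable_const M) ?_
    filter_upwards [hb] with x hx
    exact hx S

end RestAux

namespace RestAux

/-- The kernel identity, as a property of the family. -/
def KerId (n : ℕ) (a : ℕ → ℕ) (Y : (k : ℕ) → Fin (a k) → MvPolynomial (Fin n) ℂ) : Prop :=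
  ∀ (k : ℕ) (θ x : En n), ‖θ‖ = 1 →
    ∑ m, evalR (Y k m) θ * (starRingEnd ℂ) (evalR (Y k m) x) =
      ((Qr (n / 2) (inner ℝ θ x) (‖x‖ ^ 2) k / omegaN n : ℝ) : ℂ)

variable {n : ℕ} {a : ℕ → ℕ} {Y : (k : ℕ) → Fin (a k) → MvPolynomial (Fin n) ℂ}

lemma ker_diag (hK : KerId n a Y) (k : ℕ) {η : En n} (hη : ‖η‖ = 1) :
    ∑ m, ‖evalR (Y k m) η‖ ^ 2 = Qr (n / 2) 1 1 k / omegaN n := by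
  have h := hK k η η hη
  rw [real_inner_self_eq_norm_sq, hη, one_pow] at h
  apply Complex.ofReal_injective
  rw [← h]
  push_cast
  refine Finset.sum_congr rfl fun m _ => ?_
  rw [Complex.mul_conj, Complex.normSq_eq_norm_sq]
  push_cast; rfl

/-- The majorant. -/
def Hm (Y : (k : ℕ) → Fin (a k) → MvPolynomial (Fin n) ℂ) (ρ : ℝ) (η : En n)
    (p : ℕ × Σ k : ℕ, Fin (a k)) : ℝ :=
  (ρ ^ 2) ^ p.1 * (ρ ^ p.2.1 * ‖evalR (Y p.2.1 p.2.2) η‖ ^ 2)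

lemma Q11_summable (l : ℝ) {ρ : ℝ} (h0 : 0 ≤ ρ) (h1 : ρ < 1) :
    Summable fun k => ρ ^ k * Qr l 1 1 k := by
  have h := gen3 l (s := 1) (q := 1) (by norm_num) (w := (ρ : ℂ)) (by simpa [abs_of_nonneg h0] using h1)
  have h2 := h.summable
  rw [← Complex.summable_ofReal]
  refine h2.congr fun k => ?_
  push_cast; ring

lemma Hm_fib (hK : KerId n a Y) (ρ : ℝ) {η : En n} (hη : ‖η‖ = 1) (k : ℕ) :
    HasSum (fun m : Fin (a k) => ρ ^ k * ‖evalR (Y k m) η‖ ^ 2)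
      (ρ ^ k * (Qr (n / 2) 1 1 k / omegaN n)) := by
  rw [← ker_diag hK k hη, Finset.mul_sum]
  exact hasSum_fintype _

lemma Q11_summable2 {ρ : ℝ} (h0 : 0 ≤ ρ) (h1 : ρ < 1) :
    Summable fun k => ρ ^ k * (Qr (n / 2) 1 1 k / omegaN n) := by
  refine ((Q11_summable (n / 2) h0 h1).mul_right (omegaN n)⁻¹).congr fun k => ?_
  rw [mul_assoc, div_eq_mul_inv (Qr (n / 2) 1 1 k)]

lemma Hm_sig (hK : KerId n a Y) {ρ : ℝ} (h0 : 0 ≤ ρ) (h1 : ρ < 1) {η : En n} (hη : ‖η‖ = 1) :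
    Summable fun p : Σ k : ℕ, Fin (a k) => ρ ^ p.1 * ‖evalR (Y p.1 p.2) η‖ ^ 2 := by
  refine (summable_sigma_of_nonneg fun p => mul_nonneg (pow_nonneg h0 _) (sq_nonneg _)).2
    ⟨fun k => (Hm_fib hK ρ hη k).summable, ?_⟩
  exact (Q11_summable2 (n := n) h0 h1).congr fun k => ((Hm_fib hK ρ hη k).tsum_eq).symm

lemma Hm_sig2 (hK : KerId n a Y) {ρ : ℝ} (h0 : 0 ≤ ρ) (h1 : ρ < 1) {η : En n} (hη : ‖η‖ = 1) :
    HasSum (fun p : Σ k : ℕ, Fin (a k) => ρ ^ p.1 * ‖evalR (Y p.1 p.2) η‖ ^ 2)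
      (∑' k, ρ ^ k * (Qr (n / 2) 1 1 k / omegaN n)) :=
  HasSum.sigma_of_hasSum (Q11_summable2 (n := n) h0 h1).hasSum (fun k => Hm_fib hK ρ hη k)
    (Hm_sig hK h0 h1 hη)

lemma Hm_hasSum (hK : KerId n a Y) {ρ : ℝ} (h0 : 0 ≤ ρ) (h1 : ρ < 1) {η : En n} (hη : ‖η‖ = 1) :
    HasSum (Hm Y ρ η) ((1 - ρ ^ 2)⁻¹ * ∑' k, ρ ^ k * (Qr (n / 2) 1 1 k / omegaN n)) := by
  have g := hasSum_geometric_of_lt_one (sq_nonneg ρ) (by nlinarith : ρ ^ 2 < 1)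
  have p1 : 0 ≤ fun t : ℕ => (ρ ^ 2) ^ t := fun t => pow_nonneg (sq_nonneg ρ) t
  have p2 : 0 ≤ fun p : Σ k : ℕ, Fin (a k) => ρ ^ p.1 * ‖evalR (Y p.1 p.2) η‖ ^ 2 :=
    fun p => mul_nonneg (pow_nonneg h0 _) (sq_nonneg _)
  have s3 := Summable.mul_of_nonneg g.summable (Hm_sig hK h0 h1 hη) p1 p2
  have s4 := HasSum.mul g (Hm_sig2 hK h0 h1 hη) s3
  exact s4

lemma unit_vec {θ : En n} (hθ : ‖θ‖ = 1) (x : En n) : ∃ η : En n, ‖η‖ = 1 ∧ x = ‖x‖ • η := by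
  by_cases hx : x = 0
  · exact ⟨θ, hθ, by simp [hx]⟩
  · have : ‖x‖ ≠ 0 := by simpa using hx
    exact ⟨‖x‖⁻¹ • x, by rw [norm_smul, norm_inv, norm_norm, inv_mul_cancel₀ this],
      by rw [smul_smul, mul_inv_cancel₀ this, one_smul]⟩

/-- The terms. -/
def Ft (Y : (k : ℕ) → Fin (a k) → MvPolynomial (Fin n) ℂ) (ζ : ℂ) (θ : En n)
    (p : ℕ × Σ k : ℕ, Fin (a k)) (x : En n) : ℂ :=
  ((‖x‖ : ℂ) ^ 2 / ζ ^ 2) ^ p.1 *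
    (evalR (Y p.2.1 p.2.2) θ * (starRingEnd ℂ) (evalR (Y p.2.1 p.2.2) x) * ζ⁻¹ ^ p.2.1)

lemma Ft_bound (hYhom : ∀ (k : ℕ) (m : Fin (a k)), (Y k m).IsHomogeneous k)
    {ζ : ℂ} {R : ℝ} (hR0 : 0 ≤ R) (hR : R < ‖ζ‖) (θ : En n)
    {x η : En n} (hx : ‖x‖ ≤ R) (hxη : x = ‖x‖ • η) (p : ℕ × Σ k : ℕ, Fin (a k)) :
    ‖Ft Y ζ θ p x‖ ≤ 2⁻¹ * (Hm Y (R / ‖ζ‖) θ p + Hm Y (R / ‖ζ‖) η p) := by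
  obtain ⟨t, k, m⟩ := p
  have hz : 0 < ‖ζ‖ := hR0.trans_lt hR
  have hr : ‖x‖ / ‖ζ‖ ≤ R / ‖ζ‖ := by gcongr
  have e : ‖evalR (Y k m) x‖ = ‖x‖ ^ k * ‖evalR (Y k m) η‖ := by
    conv_lhs => rw [hxη, evalR_hom (hYhom k m)]
    simp
  have e2 : ‖Ft Y ζ θ (t, ⟨k, m⟩) x‖ = ((‖x‖ / ‖ζ‖) ^ 2) ^ t * (‖x‖ / ‖ζ‖) ^ k *
      (‖evalR (Y k m) θ‖ * ‖evalR (Y k m) η‖) := by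
    simp only [Ft, norm_mul, norm_pow, norm_div, norm_inv, Complex.norm_real, norm_norm,
      RCLike.norm_conj, e, div_pow, inv_pow]
    ring
  rw [e2]
  simp only [Hm]
  have h3 : ‖evalR (Y k m) θ‖ * ‖evalR (Y k m) η‖ ≤
      2⁻¹ * (‖evalR (Y k m) θ‖ ^ 2 + ‖evalR (Y k m) η‖ ^ 2) := by
    nlinarith [sq_nonneg (‖evalR (Y k m) θ‖ - ‖evalR (Y k m) η‖)]
  calc _ ≤ ((R / ‖ζ‖) ^ 2) ^ t * (R / ‖ζ‖) ^ k *
      (2⁻¹ * (‖evalR (Y k m) θ‖ ^ 2 + ‖evalR (Y k m) η‖ ^ 2)) := by gcongr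
    _ = _ := by ring

lemma Ft_sum_le (hK : KerId n a Y) (hYhom : ∀ (k : ℕ) (m : Fin (a k)), (Y k m).IsHomogeneous k)
    {ζ : ℂ} {R : ℝ} (hR0 : 0 ≤ R) (hR : R < ‖ζ‖) {θ : En n} (hθ : ‖θ‖ = 1) :
    ∃ M : ℝ, 0 ≤ M ∧ ∀ x : En n, ‖x‖ ≤ R → ∀ S : Finset (ℕ × Σ k : ℕ, Fin (a k)),
      ∑ p ∈ S, ‖Ft Y ζ θ p x‖ ≤ M := by
  have hz : 0 < ‖ζ‖ := hR0.trans_lt hR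
  have hρ0 : 0 ≤ R / ‖ζ‖ := by positivity
  have hρ1 : R / ‖ζ‖ < 1 := (div_lt_one hz).2 hR
  obtain ⟨A, H⟩ : ∃ A, ∀ η, ‖η‖ = 1 → HasSum (Hm Y (R / ‖ζ‖) η) A :=
    ⟨_, fun η hη => Hm_hasSum hK hρ0 hρ1 (η := η) hη⟩
  refine ⟨2⁻¹ * (A + A), ?_, fun x hx S => ?_⟩
  rotate_left 1
  · obtain ⟨η, hη, hxη⟩ := unit_vec hθ x
    refine (Finset.sum_le_sum fun p _ => Ft_bound hYhom hR0 hR θ hx hxη p).trans ?_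
    refine (sum_le_hasSum S (fun p _ => ?_) (((H θ hθ).add (H η hη)).mul_left 2⁻¹))
    simp only [Hm]; positivity
  · have := (H θ hθ).nonneg fun p => by simp only [Hm]; positivity
    positivity

lemma Ft_hasSum (hn : 2 ≤ n) (hK : KerId n a Y)
    (hYhom : ∀ (k : ℕ) (m : Fin (a k)), (Y k m).IsHomogeneous k)
    {ζ : ℂ} {R : ℝ} (hR0 : 0 ≤ R) (hR : R < ‖ζ‖) {θ : En n} (hθ : ‖θ‖ = 1)
    {x : En n} (hx : ‖x‖ ≤ R) :
    HasSum (fun p => Ft Y ζ θ p x) ((omegaN n : ℂ)⁻¹ * (ζ ^ n / rPow n ζ θ x)) := by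
  have hz : 0 < ‖ζ‖ := hR0.trans_lt hR
  have hz0 : ζ ≠ 0 := norm_pos_iff.1 hz
  obtain ⟨M, -, hM⟩ := Ft_sum_le hK hYhom hR0 hR hθ
  have s1 : Summable fun p => Ft Y ζ θ p x :=
    (summable_of_sum_le (fun p => norm_nonneg _) (hM x hx)).of_norm
  have hq : ‖(‖x‖ : ℂ) ^ 2 / ζ ^ 2‖ < 1 := by
    rw [← div_pow, norm_pow, norm_div, Complex.norm_real, norm_norm]
    have : ‖x‖ / ‖ζ‖ < 1 := (div_lt_one hz).2 (hx.trans_lt hR)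
    have h0 : 0 ≤ ‖x‖ / ‖ζ‖ := by positivity
    nlinarith
  have g := hasSum_geometric_of_norm_lt_one hq
  have hs : (inner ℝ θ x) ^ 2 ≤ ‖x‖ ^ 2 := by
    have := abs_real_inner_le_norm θ x
    rw [hθ, one_mul] at this
    exact sq_le_sq.2 (by rwa [abs_norm])
  have g3 := gen3 (n / 2) hs (w := ζ⁻¹) (by
    rw [Real.sqrt_sq (norm_nonneg x), norm_inv, ← div_eq_mul_inv]
    exact (div_lt_one hz).2 (hx.trans_lt hR))
  have s2 : Summable fun p : Σ k : ℕ, Fin (a k) =>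
      (evalR (Y p.1 p.2) θ * (starRingEnd ℂ) (evalR (Y p.1 p.2) x) * ζ⁻¹ ^ p.1) := by
    have := s1.comp_injective (i := fun p : Σ k : ℕ, Fin (a k) => ((0 : ℕ), p))
      (fun p q h => (Prod.mk.inj h).2)
    simpa [Function.comp_def, Ft] using this
  have g4 := HasSum.sigma_of_hasSum (g3.mul_left (omegaN n : ℂ)⁻¹) (fun k => by
    have := hasSum_fintype (fun m : Fin (a k) =>
      evalR (Y k m) θ * (starRingEnd ℂ) (evalR (Y k m) x) * ζ⁻¹ ^ k)
    rw [← Finset.sum_mul, hK k θ x hθ] at this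
    have e : (omegaN n : ℂ)⁻¹ * (((Qr (n / 2) (inner ℝ θ x) (‖x‖ ^ 2) k : ℝ) : ℂ) * ζ⁻¹ ^ k) =
      ((Qr (n / 2) (inner ℝ θ x) (‖x‖ ^ 2) k / omegaN n : ℝ) : ℂ) * ζ⁻¹ ^ k := by
      push_cast; ring
    rw [e]
    exact this) s2
  have g5 := g.mul g4 s1
  have hne : (1 : ℂ) - (‖x‖ : ℂ) ^ 2 / ζ ^ 2 ≠ 0 := by
    intro h
    rw [← sub_eq_zero.1 h] at hq
    simp at hq
  have hzn : ζ ^ n ≠ 0 := pow_ne_zero _ hz0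
  have e : (omegaN n : ℂ)⁻¹ * (ζ ^ n / rPow n ζ θ x) = (1 - (‖x‖ : ℂ) ^ 2 / ζ ^ 2)⁻¹ *
      ((omegaN n : ℂ)⁻¹ * ((1 - ((‖x‖ ^ 2 : ℝ) : ℂ) * ζ⁻¹ ^ 2) *
      (1 / (1 - 2 * ((inner ℝ θ x : ℝ) : ℂ) * ζ⁻¹ + ((‖x‖ ^ 2 : ℝ) : ℂ) * ζ⁻¹ ^ 2) ^
        (((n : ℝ) / 2 : ℝ) : ℂ)))) := by
    rw [rPow, ← div_div, div_self hzn]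
    push_cast
    rw [inv_pow, ← div_eq_mul_inv, ← div_eq_mul_inv, mul_left_comm, inv_mul_cancel_left₀ hne]
  rw [e]
  exact g5

end RestAux

namespace RestAux

lemma Ft_int {n : ℕ} {a : ℕ → ℕ} {Y : (k : ℕ) → Fin (a k) → MvPolynomial (Fin n) ℂ}
    (hn : 2 ≤ n) (hK : KerId n a Y)
    (hYhom : ∀ (k : ℕ) (m : Fin (a k)), (Y k m).IsHomogeneous k)
    (P : MvPolynomial (Fin n) ℂ)
    {ζ : ℂ} {R : ℝ} (hR0 : 0 ≤ R) (hR : R < ‖ζ‖) {θ : En n} (hθ : ‖θ‖ = 1)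
    (ν : Measure (En n)) [IsFiniteMeasure ν] (hν : ν (closedBall 0 R)ᶜ = 0) :
    HasSum (fun p : ℕ × Σ k : ℕ, Fin (a k) =>
        evalR (Y p.2.1 p.2.2) θ / ζ ^ (2 * p.1 + p.2.1 + 1) *
          ∫ x, evalR P x * (‖x‖ : ℂ) ^ (2 * p.1) *
            (starRingEnd ℂ) (evalR (Y p.2.1 p.2.2) x) ∂ν)
      ((omegaN n : ℂ)⁻¹ * ∫ x, evalR P x * ζ ^ (n - 1) / rPow n ζ θ x ∂ν) := by
  have hz : 0 < ‖ζ‖ := hR0.trans_lt hR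
  have hz0 : ζ ≠ 0 := norm_pos_iff.1 hz
  obtain ⟨M, hM0, hM⟩ := Ft_sum_le hK hYhom hR0 hR hθ
  obtain ⟨B, hB⟩ := (isCompact_closedBall (0 : En n) R).exists_bound_of_continuousOn
    (continuous_evalR P).continuousOn
  have hae : ∀ᵐ x ∂ν, ‖x‖ ≤ R := by
    rw [ae_iff]
    convert hν using 2
    ext x; simp
  have h := interch ν (fun (p : ℕ × Σ k : ℕ, Fin (a k)) x => evalR P x / ζ * Ft Y ζ θ p x)
    (fun x => evalR P x / ζ * ((omegaN n : ℂ)⁻¹ * (ζ ^ n / rPow n ζ θ x))) (B / ‖ζ‖ * M)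
    (fun p => by
      refine Continuous.aestronglyMeasurable ?_
      have c1 := continuous_evalR P
      have c2 := continuous_evalR (Y p.2.1 p.2.2)
      have c3 : Continuous fun x : En n => (starRingEnd ℂ) (evalR (Y p.2.1 p.2.2) x) :=
        Complex.continuous_conj.comp c2
      have c4 : Continuous fun x : En n => ((‖x‖ : ℝ) : ℂ) :=
        Complex.continuous_ofReal.comp continuous_norm
      unfold Ft
      exact (c1.div_const _).mul ((((c4.pow 2).div_const _).pow _).mul
        ((continuous_const.mul c3).mul continuous_const)))
    (by
      filter_upwards [hae] with x hx S
      simp only [norm_mul, norm_div, ← Finset.mul_sum]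
      have hb : ‖evalR P x‖ ≤ B := hB x (by simpa using hx)
      have hb0 : 0 ≤ B := (norm_nonneg _).trans hb
      have := hM x hx S
      have h0 : 0 ≤ ∑ p ∈ S, ‖Ft Y ζ θ p x‖ := Finset.sum_nonneg fun _ _ => norm_nonneg _
      exact mul_le_mul (by gcongr) this h0 (by positivity))
    (by
      filter_upwards [hae] with x hx
      exact (Ft_hasSum hn hK hYhom hR0 hR hθ hx).mul_left _)
  have e1 : (fun p : ℕ × Σ k : ℕ, Fin (a k) =>
        evalR (Y p.2.1 p.2.2) θ / ζ ^ (2 * p.1 + p.2.1 + 1) *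
          ∫ x, evalR P x * (‖x‖ : ℂ) ^ (2 * p.1) *
            (starRingEnd ℂ) (evalR (Y p.2.1 p.2.2) x) ∂ν) =
      fun p => ∫ x, evalR P x / ζ * Ft Y ζ θ p x ∂ν := by
    funext p
    rw [← integral_const_mul]
    refine integral_congr_ae (Filter.Eventually.of_forall fun x => ?_)
    simp only [Ft]
    rw [pow_add, pow_add, pow_mul, pow_mul, div_pow, inv_pow, pow_one]
    field_simp
  have e2 : (omegaN n : ℂ)⁻¹ * ∫ x, evalR P x * ζ ^ (n - 1) / rPow n ζ θ x ∂ν =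
      ∫ x, evalR P x / ζ * ((omegaN n : ℂ)⁻¹ * (ζ ^ n / rPow n ζ θ x)) ∂ν := by
    rw [← integral_const_mul]
    refine integral_congr_ae (Filter.Eventually.of_forall fun x => ?_)
    obtain ⟨j, rfl⟩ : ∃ j, n = j + 1 := ⟨n - 1, by omega⟩
    simp only [Nat.add_sub_cancel]
    have : ζ ^ (j + 1) / rPow (j + 1) ζ θ x = ζ * (ζ ^ j / rPow (j + 1) ζ θ x) := by
      rw [pow_succ]; ring
    rw [this]
    have h4 : evalR P x / ζ * ζ = evalR P x := div_mul_cancel₀ _ hz0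
    linear_combination (-(((omegaN (j + 1) : ℝ) : ℂ)⁻¹ * (ζ ^ j / rPow (j + 1) ζ θ x))) * h4
  rw [e1, e2]
  exact h

end RestAux

/-- Asymptotic expansion of the rest function `R_P`. -/
theorem restFunction_asymptotic_expansion
    (n : ℕ) (hn : 2 ≤ n) (R : ℝ)
    (μ : SignedMeasure (En n)) (hμ : SuppIn μ (closedBall (0 : En n) R))
    (P : MvPolynomial (Fin n) ℂ)
    (a : ℕ → ℕ) (Y : (k : ℕ) → Fin (a k) → MvPolynomial (Fin n) ℂ)
    (hYhom : ∀ (k : ℕ) (m : Fin (a k)), (Y k m).IsHomogeneous k)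
    (hYharm : ∀ (k : ℕ) (m : Fin (a k)), IsHarmonicPoly n (Y k m))
    (hYon : ∀ (k : ℕ) (m m' : Fin (a k)),
      ∫ θ : sphere (0 : En n) 1, evalR (Y k m) (θ : En n) *
        (starRingEnd ℂ) (evalR (Y k m') (θ : En n)) ∂(sphereMeasure n)
      = if m = m' then 1 else 0)
    (hYbasis : ∀ (k : ℕ) (Q : MvPolynomial (Fin n) ℂ), Q.IsHomogeneous k →
      IsHarmonicPoly n Q → ∃ c : Fin (a k) → ℂ, Q = ∑ m, c m • Y k m) :
    ∀ (ζ : ℂ), R < ‖ζ‖ → ∀ θ : sphere (0 : En n) 1,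
      HasSum (fun p : ℕ × Σ k : ℕ, Fin (a k) =>
        evalR (Y p.2.1 p.2.2) (θ : En n) / ζ ^ (2 * p.1 + p.2.1 + 1) *
          sInt μ (fun x => evalR P x * (‖x‖ : ℂ) ^ (2 * p.1) *
            (starRingEnd ℂ) (evalR (Y p.2.1 p.2.2) x)))
        (restP μ P ζ (θ : En n)) := by
  intro ζ hζ θ
  have hθ : ‖(θ : En n)‖ = 1 := by simp
  unfold SuppIn SignedMeasure.totalVariation at hμ
  rw [Measure.add_apply, add_eq_zero] at hμ
  unfold restP sInt
  rcases lt_or_ge R 0 with hR | hR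
  · have hc : (closedBall (0 : En n) R)ᶜ = Set.univ := by
      rw [closedBall_eq_empty.2 hR, Set.compl_empty]
    rw [hc, Measure.measure_univ_eq_zero, Measure.measure_univ_eq_zero] at hμ
    simp only [hμ.1, hμ.2, integral_zero_measure, sub_self, mul_zero]
    exact hasSum_zero
  · have hK : RestAux.KerId n a Y := fun k θ x h =>
      RestAux.kernel hn (Y k) (hYhom k) (hYharm k) (hYon k) (hYbasis k) h x
    have h1 := RestAux.Ft_int hn hK hYhom P hR hζ hθ _ hμ.1
    have h2 := RestAux.Ft_int hn hK hYhom P hR hζ hθ _ hμ.2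
    have h3 := h1.sub h2
    simp only [← mul_sub] at h3
    exact h3
end
end

section
/- Let μ be a finite signed measure on ℝⁿ (n ≥ 2) with compact support, let P be a polynomial on ℝⁿ, and let M ∈ ℕ. Then ∫ P(x) Q(x) dμ(x) = 0 for all polynomials Q of total degree < M if and only if r_0[P] = r_1[P] = … = r_{M−1}[P] = 0, where r_s[P] are the Laurent coefficient functions of the rest function R_P. -/
open MeasureTheory Metric MvPolynomial

noncomputable section

set_option linter.unusedSectionVars false
set_option linter.unusedSimpArgs false

section Alg
variable {n : ℕ} {A : Type*} [CommRing A] [Algebra ℂ A]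

def tB (x : Fin n → A) : MvPolynomial (Fin n) A := ∑ i, C (x i) * X i
def sB (n : ℕ) (A : Type*) [CommRing A] : MvPolynomial (Fin n) A := ∑ i, X i ^ 2
def lapB (G : MvPolynomial (Fin n) A) : MvPolynomial (Fin n) A := ∑ i, pderiv i (pderiv i G)

def Kil (L : A →ₗ[ℂ] ℂ) (G : MvPolynomial (Fin n) A) : Prop := ∀ m, L (coeff m G) = 0

lemma Kil.add {L : A →ₗ[ℂ] ℂ} {F G : MvPolynomial (Fin n) A} (hF : Kil L F) (hG : Kil L G) :
    Kil L (F + G) := fun m => by simp [hF m, hG m]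
lemma Kil.sum {L : A →ₗ[ℂ] ℂ} {ι : Type*} (s : Finset ι) {F : ι → MvPolynomial (Fin n) A}
    (hF : ∀ i ∈ s, Kil L (F i)) :
    Kil L (∑ i ∈ s, F i) := fun m => by
  rw [coeff_sum, map_sum]; exact Finset.sum_eq_zero fun i hi => hF i hi m
lemma Kil.smul {L : A →ₗ[ℂ] ℂ} {G : MvPolynomial (Fin n) A} (hG : Kil L G) (c : ℂ) :
    Kil L (c • G) := fun m => by simp [hG m]
lemma Kil.mulX {L : A →ₗ[ℂ] ℂ} {G : MvPolynomial (Fin n) A} (hG : Kil L G) (i : Fin n) :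
    Kil L (G * X i) := fun m => by
  classical
  rw [coeff_mul_X']; split_ifs
  · exact hG _
  · simp
lemma Kil.pd {L : A →ₗ[ℂ] ℂ} {G : MvPolynomial (Fin n) A} (hG : Kil L G) (i : Fin n) :
    Kil L (pderiv i G) := fun m => by
  have h : coeff m (pderiv i G) = ((m i + 1 : ℕ) : ℂ) • coeff (m + Finsupp.single i 1) G := by
    rw [coeff_pderiv, Nat.cast_smul_eq_nsmul, nsmul_eq_mul]; push_cast; ring
  rw [h, map_smul, hG]; simp
lemma Kil.lapl {L : A →ₗ[ℂ] ℂ} {G : MvPolynomial (Fin n) A} (hG : Kil L G) :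
    Kil L (sB n A * lapB G) := by
  unfold sB lapB
  rw [Finset.sum_mul]
  refine Kil.sum _ fun i _ => ?_
  have : X i ^ 2 * ∑ j, pderiv j (pderiv j G) = (∑ j, pderiv j (pderiv j G)) * X i * X i := by ring
  rw [this]
  exact ((Kil.sum _ fun j _ => (hG.pd j).pd j).mulX i).mulX i

lemma pd_t (x : Fin n → A) (i : Fin n) : pderiv i (tB x) = C (x i) := by
  classical
  simp [tB, pderiv_C_mul, pderiv_X, Pi.single_apply]
lemma pd_s (i : Fin n) : pderiv i (sB n A) = 2 * X i := by
  classical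
  simp [sB, pderiv_pow, pderiv_X, Pi.single_apply]

lemma sum_x (x : Fin n → A) : ∑ i, (C (x i) : MvPolynomial (Fin n) A) * X i = tB x := rfl
lemma sum_X : ∑ i, (X i : MvPolynomial (Fin n) A) ^ 2 = sB n A := rfl

lemma pd_ts (x : Fin n → A) (a k : ℕ) (i : Fin n) :
    pderiv i (tB x ^ a * sB n A ^ k) =
      (a : MvPolynomial (Fin n) A) * (tB x ^ (a-1) * sB n A ^ k) * C (x i) + 2 * (k : MvPolynomial (Fin n) A) * (tB x ^ a * sB n A ^ (k-1)) * X i := by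
  rw [pderiv_mul, pderiv_pow, pderiv_pow, pd_t, pd_s]; ring

lemma pd2_ts (x : Fin n → A) (a k : ℕ) (i : Fin n) :
    pderiv i (pderiv i (tB x ^ a * sB n A ^ k)) =
      ((a : MvPolynomial (Fin n) A) * ((a-1 : ℕ) : MvPolynomial (Fin n) A) * tB x ^ (a-1-1) * sB n A ^ k) * C (x i)^2
      + (4 * (a : MvPolynomial (Fin n) A) * (k : MvPolynomial (Fin n) A) * tB x ^ (a-1) * sB n A ^ (k-1)) * (C (x i) * X i)
      + 2 * (k : MvPolynomial (Fin n) A) * (tB x ^ a * sB n A ^ (k-1))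
      + (4 * (k : MvPolynomial (Fin n) A) * ((k-1 : ℕ) : MvPolynomial (Fin n) A) * tB x ^ a * sB n A ^ (k-1-1)) * X i ^ 2 := by
  have hN : ∀ (m : ℕ), pderiv i ((m : ℕ) : MvPolynomial (Fin n) A) = 0 := fun m => by
    simp
  have h2 : pderiv i ((2 : MvPolynomial (Fin n) A)) = 0 := by
    simpa using hN 2
  rw [pd_ts, map_add]
  simp only [pderiv_mul, pderiv_pow, pd_t, pd_s, hN, h2, pderiv_C, pderiv_X_self]
  ring

lemma lap_ts (x : Fin n → A) (a k : ℕ) :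
    sB n A * lapB (tB x ^ a * sB n A ^ k) =
      ((a * (a-1 : ℕ) : ℕ) : ℂ) • (C (∑ i, x i ^ 2) * tB x ^ (a-2) * sB n A ^ (k+1))
      + ((2 * k * (2 * a + n + 2 * (k - 1 : ℕ)) : ℕ) : ℂ) • (tB x ^ a * sB n A ^ k) := by
  unfold lapB
  simp only [pd2_ts, Finset.sum_add_distrib, ← Finset.mul_sum, sum_x, sum_X, ← map_pow, ← map_sum]
  rw [Nat.cast_smul_eq_nsmul, Nat.cast_smul_eq_nsmul, nsmul_eq_mul, nsmul_eq_mul]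
  rw [show a - 1 - 1 = a - 2 from rfl]
  simp only [Finset.sum_const, Finset.card_univ, Fintype.card_fin, nsmul_eq_mul]
  push_cast
  rcases k with _ | _ | k
  · simp; ring
  · rcases a with _ | a
    · simp; ring
    · simp; ring
  · rcases a with _ | a
    · simp; ring
    · simp; ring

/-- basis elements -/
def bB (x : Fin n → A) (s k : ℕ) : MvPolynomial (Fin n) A :=
  C (∑ i, x i ^ 2) ^ k * (tB x ^ (s - 2 * k) * sB n A ^ k)

lemma lap_b (x : Fin n → A) (s k : ℕ) (hk : 2 * k ≤ s) :
    sB n A * lapB (bB x s k) =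
      (((s - 2 * k : ℂ)) * (s - 2 * k - 1)) • bB x s (k+1)
      + (2 * k * (n - 2 + 2 * s - 2 * k) : ℂ) • bB x s k := by
  have h1 : sB n A * lapB (bB x s k) =
      C (∑ i, x i ^ 2) ^ k * (sB n A * lapB (tB x ^ (s - 2 * k) * sB n A ^ k)) := by
    unfold lapB bB
    simp only [← map_pow, pderiv_C_mul, ← Finset.mul_sum]
    ring
  rw [h1, lap_ts, mul_add, mul_smul_comm, mul_smul_comm]
  obtain ⟨a, rfl⟩ := Nat.exists_eq_add_of_le hk
  congr 1
  · rw [bB, show 2 * k + a - 2 * (k+1) = a - 2 by omega, show 2 * k + a - 2 * k = a by omega]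
    congr 1
    · rcases a with _ | a <;> push_cast [Nat.add_sub_cancel] <;> ring
    · ring
  · rw [bB, show 2 * k + a - 2 * k = a by omega]
    congr 1
    rcases k with _ | k <;> push_cast [Nat.add_sub_cancel] <;> ring

/-- coefficients -/
def cf (s k : ℕ) (l : ℂ) : ℂ :=
  (-1) ^ k * 2 ^ (s - 2 * k) * (ascPochhammer ℂ (s - k)).eval l / (k.factorial * (s - 2 * k).factorial)

def vB (x : Fin n → A) (s : ℕ) (l : ℂ) : MvPolynomial (Fin n) A :=
  ∑ k ∈ Finset.range (s / 2 + 1), cf s k l • bB x s k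

lemma asc_shift (m : ℕ) (l : ℂ) :
    l * (ascPochhammer ℂ m).eval (l + 1) = (ascPochhammer ℂ m).eval l * (l + m) := by
  rw [← ascPochhammer_succ_eval, ascPochhammer_succ_left]
  simp [Polynomial.eval_comp]

lemma cf_zero (s : ℕ) (N : ℂ) (l : ℂ) :
    (2 * l + 2 * s) * (2 * l + 2 - N) * cf s 0 l = 2 * l * (2 * l + 2 - N) * cf s 0 (l + 1) := by
  have := asc_shift s l
  simp only [cf, Nat.sub_zero, mul_zero]
  linear_combination (-2 * (2 * l + 2 - N) * (-1) ^ 0 * 2 ^ s / ((0).factorial * s.factorial)) * this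

lemma cf_succ (s k : ℕ) (hk : 2 * (k + 1) ≤ s) (N : ℂ) (l : ℂ) :
    (s - 2 * k : ℂ) * (s - 2 * k - 1) * cf s k l
     + (2 * (k + 1) * (N - 2 + 2 * s - 2 * (k+1)) + (2 * l + 2 * s) * (2 * l + 2 - N)) * cf s (k+1) l
     = 2 * l * (2 * l + 2 - N) * cf s (k+1) (l + 1) := by
  obtain ⟨a, rfl⟩ := Nat.exists_eq_add_of_le hk
  have := asc_shift (k+1+a) l
  simp only [cf]
  rw [show 2 * (k + 1) + a - 2 * k = a + 2 by omega, show 2 * (k + 1) + a - k = (k + 1 + a) + 1 by omega,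
    show 2 * (k+1) + a - 2 * (k+1) = a by omega, show 2 * (k+1) + a - (k+1) = k+1+a by omega,
    ascPochhammer_succ_eval, Nat.factorial_succ (a+1), Nat.factorial_succ a, Nat.factorial_succ k]
  have h1 : (a.factorial : ℂ) ≠ 0 := by exact_mod_cast a.factorial_ne_zero
  have h2 : (k.factorial : ℂ) ≠ 0 := by exact_mod_cast k.factorial_ne_zero
  have h3 : (a + 1 : ℂ) ≠ 0 := by exact_mod_cast a.succ_ne_zero
  have h4 : (a + 1 + 1 : ℂ) ≠ 0 := by exact_mod_cast (a+1).succ_ne_zero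
  have h5 : (k + 1 : ℂ) ≠ 0 := by exact_mod_cast k.succ_ne_zero
  push_cast at this ⊢
  set e := Polynomial.eval l (ascPochhammer ℂ (k+1+a))
  set e' := Polynomial.eval (l+1) (ascPochhammer ℂ (k+1+a))
  field_simp
  linear_combination (-2 * (2 * l + 2 - N) * (-1) ^ (k + 1) * (a + 1) * (a + 2) * 2 ^ a) * this

lemma lap_v (x : Fin n → A) (s : ℕ) (l : ℂ) :
    sB n A * lapB (vB x s l) + ((2 * l + 2 * s) * (2 * l + 2 - n)) • vB x s l
      = (2 * l * (2 * l + 2 - n)) • vB x s (l + 1) := by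
  have h1 : sB n A * lapB (vB x s l) = ∑ k ∈ Finset.range (s / 2 + 1),
      cf s k l • (sB n A * lapB (bB x s k)) := by
    unfold lapB vB
    have hp : ∀ (i : Fin n) (c : ℂ) (G : MvPolynomial (Fin n) A), pderiv i (c • G) = c • pderiv i G := by
      intro i c G
      rw [algebra_compatible_smul A c G, Derivation.map_smul, ← algebra_compatible_smul]
    simp only [map_sum, hp]
    rw [Finset.sum_comm]
    simp only [← Finset.smul_sum, Finset.mul_sum, mul_smul_comm]
  rw [h1, Finset.sum_congr rfl (fun k hk => by
    rw [lap_b x s k (by have := Finset.mem_range.1 hk; omega)])]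
  simp only [smul_add, smul_smul, Finset.sum_add_distrib]
  rw [Finset.sum_range_succ (fun k => (cf s k l * ((s - 2 * k : ℂ) * (s - 2 * k - 1))) • bB x s (k+1))]
  have h0 : (s - 2 * (s / 2 : ℕ) : ℂ) * (s - 2 * (s / 2 : ℕ) - 1) = 0 := by
    rcases Nat.even_or_odd' s with ⟨m, rfl | rfl⟩
    · rw [show 2 * m / 2 = m by omega]; push_cast; ring
    · rw [show (2 * m + 1) / 2 = m by omega]; push_cast; ring
  rw [h0]
  simp only [vB, Finset.smul_sum, smul_smul]
  simp only [Finset.sum_range_succ' _ (s/2), mul_zero, zero_smul, add_zero]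
  rw [show ∀ a b c d e : MvPolynomial (Fin n) A, a + (b + c) + (d + e) = (a + b + d) + (c + e) by
    intros; abel, ← Finset.sum_add_distrib, ← Finset.sum_add_distrib]
  congr 1
  · refine Finset.sum_congr rfl fun k hk => ?_
    rw [← add_smul, ← add_smul, ← cf_succ s k (by have := Finset.mem_range.1 hk; omega)]
    congr 1; push_cast; ring
  · rw [← add_smul, ← cf_zero]
    congr 1; push_cast; ring

lemma Kil.step {L : A →ₗ[ℂ] ℂ} (x : Fin n → A) (s : ℕ) (h : Kil L (vB x s (n / 2))) (hn : 2 ≤ n)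
    (i : ℕ) : Kil L (vB x s (n / 2 + i)) := by
  induction i with
  | zero => simpa using h
  | succ i ih =>
    have h1 := ih.lapl.add (ih.smul ((2 * (n / 2 + i) + 2 * s) * (2 * (n / 2 + i) + 2 - n) : ℂ))
    rw [lap_v] at h1
    have h2 := h1.smul ((2 * (n / 2 + i) * (2 * (n / 2 + i) + 2 - n) : ℂ))⁻¹
    rw [smul_smul, inv_mul_cancel₀, one_smul] at h2
    · push_cast; rwa [← add_assoc]
    · rw [show (2 * (n / 2 + i) * (2 * (n / 2 + i) + 2 - n) : ℂ) = ((n + 2 * i) * (2 * i + 2) : ℕ) by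
        push_cast; ring]
      exact_mod_cast (Nat.mul_pos (by omega) (by omega)).ne'

lemma Kil.top {L : A →ₗ[ℂ] ℂ} (x : Fin n → A) (s : ℕ) (h : Kil L (vB x s (n / 2))) (hn : 2 ≤ n) :
    Kil L (tB x ^ s) := by
  intro m
  let p : Polynomial ℂ := ∑ k ∈ Finset.range (s / 2 + 1),
    Polynomial.C ((-1) ^ k * 2 ^ (s - 2 * k) / (k.factorial * (s - 2 * k).factorial) * L (coeff m (bB x s k)))
      * ascPochhammer ℂ (s - k)
  have hp : p = 0 := by
    refine Polynomial.eq_zero_of_infinite_isRoot p ?_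
    refine Set.infinite_of_injective_forall_mem (f := fun i : ℕ => (n / 2 + i : ℂ)) ?_ ?_
    · intro i j hij; simpa using hij
    · intro i
      have := Kil.step x s h hn i m
      simp only [vB, coeff_sum, coeff_smul, map_sum, map_smul, cf, smul_eq_mul] at this
      simp only [Set.mem_ofPred_eq, Polynomial.IsRoot.def, p, Polynomial.eval_finsetSum,
        Polynomial.eval_mul, Polynomial.eval_C]
      rw [← this]
      refine Finset.sum_congr rfl fun k _ => by ring
  have hc := congrArg (fun q => Polynomial.coeff q s) hp
  simp only [p, Polynomial.finsetSum_coeff, Polynomial.coeff_C_mul, Polynomial.coeff_zero] at hc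
  rw [Finset.sum_eq_single 0] at hc
  · have h1 : (ascPochhammer ℂ s).coeff s = 1 := by
      have := (monic_ascPochhammer ℂ s).coeff_natDegree
      rwa [ascPochhammer_natDegree] at this
    have h2 : (s.factorial : ℂ) ≠ 0 := by exact_mod_cast s.factorial_ne_zero
    simpa [h1, h2, bB] using hc
  · intro k hk hk0
    have := Finset.mem_range.1 hk
    rw [Polynomial.coeff_eq_zero_of_natDegree_lt, mul_zero]
    rw [ascPochhammer_natDegree]; omega
  · simp

lemma Kil.monom {L : A →ₗ[ℂ] ℂ} (x : Fin n → A) (s : ℕ) : ∀ a : A, Kil L (C a * tB x ^ s) →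
    ∀ m : Fin n →₀ ℕ, m.degree = s → L (a * m.prod fun i e => x i ^ e) = 0 := by
  induction s with
  | zero =>
    intro a h m hm
    have : m = 0 := (Finsupp.degree_eq_zero_iff m).1 hm
    subst this
    have := h 0
    simpa using this
  | succ s ih =>
    intro a h m hm
    obtain ⟨i, hi⟩ : ∃ i, m i ≠ 0 := by
      by_contra hcon
      push Not at hcon
      have : m = 0 := Finsupp.ext hcon
      simp [this] at hm
    obtain ⟨m', rfl⟩ : ∃ m', m = m' + Finsupp.single i 1 :=
      ⟨m - Finsupp.single i 1, (tsub_add_cancel_of_le (by simpa [Nat.one_le_iff_ne_zero] using hi)).symm⟩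
    have hm' : m'.degree = s := by simpa using hm
    have h1 := (h.pd i).smul ((s + 1 : ℂ))⁻¹
    have h2 : ((s + 1 : ℂ))⁻¹ • pderiv i (C a * tB x ^ (s+1)) = C (a * x i) * tB x ^ s := by
      rw [inv_smul_eq_iff₀ (by exact_mod_cast s.succ_ne_zero), pderiv_C_mul, pderiv_pow, pd_t,
        show (s + 1 : ℂ) = ((s + 1 : ℕ) : ℂ) by push_cast; rfl, Nat.cast_smul_eq_nsmul, nsmul_eq_mul,
        map_mul]
      push_cast [Nat.add_sub_cancel]
      ring
    rw [h2] at h1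
    rw [← ih _ h1 m' hm', Finsupp.prod_add_index' (by simp) (by intros; rw [pow_add])]
    simp
    congr 1; ring

end Alg

section Ana
open Filter Topology

def aC (l : ℂ) (j : ℕ) : ℂ := (ascPochhammer ℂ j).eval l / j.factorial

lemma aC_eq (l : ℂ) (j : ℕ) : Ring.choose (l + j - 1) j = aC l j := by
  rw [← Ring.multichoose_eq, aC, eq_div_iff (by exact_mod_cast j.factorial_ne_zero),
    ← Polynomial.ascPochhammer_smeval_eq_eval, ← Ring.factorial_nsmul_multichoose_eq_ascPochhammer,
    nsmul_eq_mul, mul_comm]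

lemma aC_series (l : ℂ) : HasFPowerSeriesOnBall (fun x ↦ 1 / (1 - x) ^ l)
      (.ofScalars ℂ fun n ↦ aC l n) 0 1 := by
  have := Complex.one_div_one_sub_cpow_hasFPowerSeriesOnBall_zero l
  simpa only [aC_eq] using this

lemma aC_summable (l : ℂ) (u : ℝ) (hu : 0 ≤ u) (hu1 : u < 1) :
    Summable fun j => ‖aC l j‖ * u ^ j := by
  lift u to NNReal using hu
  have h := (FormalMultilinearSeries.ofScalars ℂ fun n ↦ aC l n).summable_norm_mul_pow (r := u)
    (lt_of_lt_of_le (by exact_mod_cast hu1) (aC_series l).r_le)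
  simpa only [FormalMultilinearSeries.ofScalars_norm] using h

lemma aC_hasSum (l w : ℂ) (hw : ‖w‖ < 1) : HasSum (fun j => aC l j * w ^ j) (1 / (1 - w) ^ l) := by
  have h := (aC_series l).hasSum (y := w) (by simpa [← ENNReal.ofReal_one, Metric.eball_ofReal] using hw)
  simpa [FormalMultilinearSeries.ofScalars_apply_eq, smul_eq_mul, mul_comm] using h

lemma row_hasSum {K : Type*} [NormedField K] (c a b : K) (j : ℕ) :
    HasSum (fun k => c * (j.choose k * a ^ (j - k) * b ^ k)) (c * (a + b) ^ j) := by
  have : c * (a + b) ^ j = ∑ k ∈ Finset.range (j + 1), c * (j.choose k * a ^ (j - k) * b ^ k) := by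
    rw [add_comm a b, add_pow, Finset.mul_sum]
    exact Finset.sum_congr rfl fun k _ => by ring
  rw [this]
  refine hasSum_sum_of_ne_finset_zero fun k hk => ?_
  rw [Nat.choose_eq_zero_of_lt (by simpa using hk)]; simp

lemma dbl_summable (l : ℂ) (a b : ℝ) (ha : 0 ≤ a) (hb : 0 ≤ b) (hab : a + b < 1) :
    Summable fun p : ℕ × ℕ => ‖aC l p.1‖ * (p.1.choose p.2 * a ^ (p.1 - p.2) * b ^ p.2) := by
  have h0 : ∀ p : ℕ × ℕ, 0 ≤ ‖aC l p.1‖ * (p.1.choose p.2 * a ^ (p.1 - p.2) * b ^ p.2) := by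
    intro p
    positivity
  have h1 : ∀ j : ℕ, HasSum (fun k : ℕ => ‖aC l j‖ * ((j.choose k : ℝ) * a ^ (j - k) * b ^ k))
    (‖aC l j‖ * (a + b) ^ j) := fun j => row_hasSum (K := ℝ) ‖aC l j‖ a b j
  have h2 := aC_summable l (a + b) (by positivity) hab
  rw [summable_prod_of_nonneg h0]
  refine ⟨fun j => (h1 j).summable, ?_⟩
  refine h2.congr fun j => ?_
  exact (h1 j).tsum_eq.symm

lemma dbl_hasSum (l a b : ℂ) (hab : ‖a‖ + ‖b‖ < 1) :
    HasSum (fun p : ℕ × ℕ => aC l p.1 * (p.1.choose p.2 * a ^ (p.1 - p.2) * b ^ p.2))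
      (1 / (1 - (a + b)) ^ l) := by
  have hs : Summable (fun p : ℕ × ℕ => aC l p.1 * (p.1.choose p.2 * a ^ (p.1 - p.2) * b ^ p.2)) := by
    refine Summable.of_norm ?_
    have := dbl_summable l ‖a‖ ‖b‖ (norm_nonneg _) (norm_nonneg _) hab
    simpa using this
  have h1 := hs.hasSum.prod_fiberwise (fun j => row_hasSum (aC l j) a b j)
  rw [← h1.unique (aC_hasSum l (a + b) ((norm_add_le _ _).trans_lt hab))]
  exact hs.hasSum

/-- sums along antidiagonals -/
lemma anti_hasSum {K : Type*} [NormedField K] (f : ℕ × ℕ → K) (S : K) (h : HasSum f S) :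
    HasSum (fun s => ∑ p ∈ Finset.HasAntidiagonal.antidiagonal s, f p) S := by
  have h1 := (Finset.HasAntidiagonal.sigmaAntidiagonalEquivProd (A := ℕ)).hasSum_iff.2 h
  refine h1.sigma fun s => ?_
  have := (Finset.HasAntidiagonal.antidiagonal s).hasSum f
  exact this

def hC (l : ℂ) (s : ℕ) (T N : ℂ) : ℂ :=
  ∑ k ∈ Finset.range (s / 2 + 1), cf s k l * (T ^ (s - 2 * k) * N ^ k)

lemma anti_eq (l : ℂ) (s : ℕ) (T N z : ℂ) :
    ∑ p ∈ Finset.HasAntidiagonal.antidiagonal s,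
      aC l p.1 * (p.1.choose p.2 * (2 * T * z) ^ (p.1 - p.2) * (-(N * z ^ 2)) ^ p.2)
      = hC l s T N * z ^ s := by
  rw [← Finset.Nat.sum_antidiagonal_swap, Finset.Nat.sum_antidiagonal_eq_sum_range_succ_mk, hC,
    Finset.sum_mul]
  symm
  refine Finset.sum_subset_zero_on_sdiff ?_ ?_ ?_
  · intro k; simp only [Finset.mem_range]; omega
  · intro k hk
    simp only [Finset.mem_sdiff, Finset.mem_range] at hk
    simp only [Prod.fst_swap, Prod.snd_swap]
    rw [Nat.choose_eq_zero_of_lt (by omega)]; simp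
  · intro k hk
    simp only [Finset.mem_range] at hk
    obtain ⟨a, rfl⟩ := Nat.exists_eq_add_of_le (show 2 * k ≤ s by omega)
    simp only [Prod.fst_swap, Prod.snd_swap, cf, aC]
    rw [show 2 * k + a - 2 * k = a by omega, show 2 * k + a - k = k + a by omega,
      show k + a - k = a by omega]
    have h0' : (k + a).choose k * k.factorial * a.factorial = (k + a).factorial := by
      have := Nat.add_choose_mul_factorial_mul_factorial a k
      rw [add_comm a k] at this
      rw [← this]; ring
    have h0 : ((k + a).choose k : ℂ) * k.factorial * a.factorial = (k + a).factorial := by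
      exact_mod_cast h0'
    have h1 : (a.factorial : ℂ) ≠ 0 := by exact_mod_cast a.factorial_ne_zero
    have h2 : (k.factorial : ℂ) ≠ 0 := by exact_mod_cast k.factorial_ne_zero
    have h3 : ((k + a).choose k : ℂ) ≠ 0 := by exact_mod_cast (Nat.choose_pos (by omega)).ne'
    rw [← h0]
    rw [neg_pow (N * z ^ 2)]
    field_simp
    ring

lemma hC_hasSum (l T N z : ℂ) (h : ‖2 * T * z‖ + ‖N * z ^ 2‖ < 1) :
    HasSum (fun s => hC l s T N * z ^ s) (1 / (1 - (2 * T * z - N * z ^ 2)) ^ l) := by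
  have := anti_hasSum _ _ (dbl_hasSum l (2 * T * z) (-(N * z ^ 2)) (by simpa using h))
  simp only [anti_eq] at this
  simpa only [sub_eq_add_neg] using this

lemma hC_bound (l : ℂ) (r : ℝ) (z : ℂ) (hr : 0 ≤ r) (h : 2 * r * ‖z‖ + r ^ 2 * ‖z‖ ^ 2 < 1) :
    ∃ G : ℕ → ℝ, Summable G ∧ ∀ T N : ℂ, ‖T‖ ≤ r → ‖N‖ ≤ r ^ 2 → ∀ s, ‖hC l s T N * z ^ s‖ ≤ G s := by
  have hs := dbl_summable l (2 * r * ‖z‖) (r ^ 2 * ‖z‖ ^ 2) (by positivity) (by positivity) h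
  refine ⟨_, (anti_hasSum _ _ hs.hasSum).summable, fun T N hT hN s => ?_⟩
  rw [← anti_eq]
  refine (norm_sum_le _ _).trans (Finset.sum_le_sum fun p _ => ?_)
  simp only [norm_mul, norm_pow, norm_neg, Complex.norm_natCast, Complex.norm_ofNat]
  gcongr

lemma coeff_unique (d : ℕ → ℂ) (ε : ℝ) (hε : 0 < ε)
    (h : ∀ z : ℂ, z ≠ 0 → ‖z‖ < ε → HasSum (fun s => d s * z ^ s) 0) : d = 0 := by
  set p := FormalMultilinearSeries.ofScalars ℂ d with hp
  have hrad : 0 < p.radius := by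
    have hz := h ((ε / 2 : ℝ) : ℂ) (by exact_mod_cast (by positivity : ε / 2 ≠ 0))
      (by rw [Complex.norm_real, Real.norm_of_nonneg (by positivity)]; linarith)
    have hs := hz.summable.norm
    have := p.le_radius_of_summable_norm (r := (ε / 2).toNNReal) (by
      simp only [hp, FormalMultilinearSeries.ofScalars_norm]
      refine hs.congr fun s => ?_
      rw [norm_mul, norm_pow, Complex.norm_real, Real.norm_of_nonneg (by positivity), Real.coe_toNNReal _ (by positivity)])
    refine lt_of_lt_of_le ?_ this
    rw [ENNReal.coe_pos, Real.toNNReal_pos]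
    exact half_pos hε
  have hF := (p.hasFPowerSeriesOnBall hrad).hasFPowerSeriesAt
  have hz : ∀ᶠ z in 𝓝[≠] (0 : ℂ), p.sum z = 0 := by
    have : ∀ᶠ z in 𝓝[≠] (0 : ℂ), ‖z‖ < ε := nhdsWithin_le_nhds (by
      have := Metric.ball_mem_nhds (0 : ℂ) hε
      filter_upwards [this] with z hz; simpa using hz)
    filter_upwards [this, self_mem_nhdsWithin] with z h1 h2
    have := (h z h2 h1).tsum_eq
    rw [← this, hp, FormalMultilinearSeries.sum]
    exact tsum_congr fun s => by simp [FormalMultilinearSeries.ofScalars_apply_eq, smul_eq_mul, mul_comm]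
  have h0 := hF.analyticAt.frequently_zero_iff_eventually_zero.1 hz.frequently
  exact (FormalMultilinearSeries.ofScalars_series_eq_zero ℂ).1 (hF.eq_zero_of_eventually h0)

end Ana

section Main

lemma evalR_cont {n : ℕ} (P : MvPolynomial (Fin n) ℂ) : Continuous (evalR P) := by
  unfold evalR
  exact (MvPolynomial.continuous_eval P).comp (by fun_prop)

lemma integrable_cont {n : ℕ} (ν : Measure (En n)) [IsFiniteMeasure ν] (R : ℝ)
    (hν : ∀ᵐ x ∂ν, x ∈ closedBall (0 : En n) R) (f : En n → ℂ) (hf : Continuous f) : Integrable f ν := by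
  obtain ⟨c, hc⟩ := (isCompact_closedBall (0 : En n) R).exists_bound_of_continuousOn hf.continuousOn
  refine Integrable.of_bound hf.aestronglyMeasurable c ?_
  filter_upwards [hν] with x hx using hc x hx

lemma supp_pos {n : ℕ} {μ : SignedMeasure (En n)} {s : Set (En n)} (h : SuppIn μ s) :
    (∀ᵐ x ∂μ.toJordanDecomposition.posPart, x ∈ s) ∧ (∀ᵐ x ∂μ.toJordanDecomposition.negPart, x ∈ s) := by
  unfold SuppIn SignedMeasure.totalVariation at h
  rw [Measure.add_apply, add_eq_zero] at h
  exact ⟨mem_ae_iff.2 h.1, mem_ae_iff.2 h.2⟩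

lemma evalR_mul {n : ℕ} (P Q : MvPolynomial (Fin n) ℂ) (x : En n) :
    evalR (P * Q) x = evalR P x * evalR Q x := by simp [evalR]
lemma evalR_add {n : ℕ} (P Q : MvPolynomial (Fin n) ℂ) (x : En n) :
    evalR (P + Q) x = evalR P x + evalR Q x := by simp [evalR]
lemma evalR_smul {n : ℕ} (c : ℂ) (Q : MvPolynomial (Fin n) ℂ) (x : En n) :
    evalR (c • Q) x = c * evalR Q x := by simp [evalR, smul_eval]

def Lfun {n : ℕ} {R : ℝ} {μ : SignedMeasure (En n)} (hμ : SuppIn μ (closedBall (0 : En n) R))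
    (P : MvPolynomial (Fin n) ℂ) : MvPolynomial (Fin n) ℂ →ₗ[ℂ] ℂ where
  toFun Q := sInt μ (fun x => evalR P x * evalR Q x)
  map_add' Q S := by
    have hc : ∀ Q : MvPolynomial (Fin n) ℂ, Continuous fun x : En n => evalR P x * evalR Q x :=
      fun Q => (evalR_cont P).mul (evalR_cont Q)
    simp only [sInt, evalR_add, mul_add]
    rw [integral_add (integrable_cont _ R (supp_pos hμ).1 _ (hc Q)) (integrable_cont _ R (supp_pos hμ).1 _ (hc S)),
      integral_add (integrable_cont _ R (supp_pos hμ).2 _ (hc Q)) (integrable_cont _ R (supp_pos hμ).2 _ (hc S))]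
    ring
  map_smul' c Q := by
    simp only [sInt, evalR_smul, mul_left_comm _ c, integral_const_mul, RingHom.id_apply, smul_eq_mul]
    ring

/-- evaluation of `vB` in the `y` variables -/
def EV (n s : ℕ) (y : Fin n → ℂ) : MvPolynomial (Fin n) ℂ :=
  eval (fun i => C (y i)) (vB (A := MvPolynomial (Fin n) ℂ) (fun i : Fin n => X i) s (n / 2))

lemma EV_eq (n s : ℕ) (y : Fin n → ℂ) : EV n s y = ∑ k ∈ Finset.range (s / 2 + 1),
    (cf s k (n / 2) * (∑ i, y i ^ 2) ^ k) • ((∑ i, X i ^ 2) ^ k * (∑ i, C (y i) * X i) ^ (s - 2 * k)) := by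
  unfold EV vB
  rw [map_sum]
  refine Finset.sum_congr rfl fun k _ => ?_
  rw [algebra_compatible_smul (MvPolynomial (Fin n) ℂ) (cf s k (n / 2)), smul_eval, bB, tB, sB]
  simp only [map_mul, map_pow, map_sum, eval_C, eval_X, MvPolynomial.algebraMap_eq, smul_eq_C_mul]
  simp only [mul_comm (X _)]
  ring

lemma EV_hom (n s : ℕ) (y : Fin n → ℂ) : (EV n s y).IsHomogeneous s := by
  rw [EV_eq]
  refine IsHomogeneous.sum _ _ _ fun k hk => ?_
  have hk' : 2 * k ≤ s := by have := Finset.mem_range.1 hk; omega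
  rw [smul_eq_C_mul]
  refine IsHomogeneous.C_mul ?_ _
  have h1 : (∑ i, X i ^ 2 : MvPolynomial (Fin n) ℂ).IsHomogeneous 2 :=
    IsHomogeneous.sum _ _ _ fun i _ => by simpa using (isHomogeneous_X ℂ i).pow 2
  have h2 : (∑ i, C (y i) * X i : MvPolynomial (Fin n) ℂ).IsHomogeneous 1 :=
    IsHomogeneous.sum _ _ _ fun i _ => (isHomogeneous_X ℂ i).C_mul _
  have := (h1.pow k).mul (h2.pow (s - 2 * k))
  rwa [show 2 * k + 1 * (s - 2 * k) = s by omega] at this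

lemma EV_smul (n s : ℕ) (y : Fin n → ℂ) (c : ℂ) : EV n s (fun i => c * y i) = c ^ s • EV n s y := by
  rw [EV_eq, EV_eq, Finset.smul_sum]
  refine Finset.sum_congr rfl fun k hk => ?_
  have hk' : 2 * k ≤ s := by have := Finset.mem_range.1 hk; omega
  obtain ⟨a, rfl⟩ := Nat.exists_eq_add_of_le hk'
  rw [show 2 * k + a - 2 * k = a by omega]
  have h1 : ∑ i, (c * y i) ^ 2 = c ^ 2 * ∑ i, y i ^ 2 := by
    rw [Finset.mul_sum]; exact Finset.sum_congr rfl fun i _ => by ring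
  have h2 : ∑ i, C (c * y i) * X i = (C c : MvPolynomial (Fin n) ℂ) * ∑ i, C (y i) * X i := by
    rw [Finset.mul_sum]; exact Finset.sum_congr rfl fun i _ => by rw [map_mul]; ring
  rw [h1, h2]
  simp only [smul_eq_C_mul, map_mul, map_pow]
  ring

lemma EV_evalR (n s : ℕ) (θ x : En n) (hθ : ‖θ‖ = 1) :
    evalR (EV n s (fun i => (θ i : ℂ))) x = hC (n / 2) s ((inner ℝ θ x : ℝ) : ℂ) ((‖x‖ : ℂ) ^ 2) := by
  have h1 : ∑ i, (θ i : ℂ) ^ 2 = 1 := by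
    have := EuclideanSpace.real_norm_sq_eq θ
    rw [hθ] at this
    have h2 : ∑ i, θ i ^ 2 = 1 := by rw [← this]; norm_num
    exact_mod_cast h2
  have h2 : ((‖x‖ : ℂ) ^ 2) = ∑ i, (x i : ℂ) ^ 2 := by
    have := EuclideanSpace.real_norm_sq_eq x
    exact_mod_cast this
  have h3 : ((inner ℝ θ x : ℝ) : ℂ) = ∑ i, (θ i : ℂ) * (x i : ℂ) := by
    rw [PiLp.inner_apply]
    push_cast
    refine Finset.sum_congr rfl fun i _ => ?_
    simp [mul_comm]
  rw [EV_eq, h1, h2, h3]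
  simp only [evalR, hC, one_pow, mul_one, map_sum, smul_eval, map_mul, map_pow, eval_X, eval_C]
  refine Finset.sum_congr rfl fun k hk => by ring

lemma hasSum_of_eq {f g : ℕ → ℂ} {a : ℂ} (h : ∀ s, f s = g s) (hg : HasSum g a) :
    HasSum f a := by
  rw [show f = g from funext h]; exact hg

lemma Kil_of_sphere (n s : ℕ) (hn : 2 ≤ n) (L : MvPolynomial (Fin n) ℂ →ₗ[ℂ] ℂ)
    (h : ∀ θ : En n, ‖θ‖ = 1 → L (EV n s (fun i => (θ i : ℂ))) = 0) :
    Kil L (vB (A := MvPolynomial (Fin n) ℂ) (fun i : Fin n => X i) s (n / 2)) := by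
  set G := vB (A := MvPolynomial (Fin n) ℂ) (fun i : Fin n => X i) s (n / 2) with hG
  let p : MvPolynomial (Fin n) ℂ := ∑ m ∈ G.support, monomial m (L (coeff m G))
  have hp : ∀ m, coeff m p = L (coeff m G) := by
    intro m
    simp only [p, coeff_sum, coeff_monomial]
    rw [Finset.sum_ite_eq' G.support m]
    split_ifs with hm
    · rfl
    · rw [notMem_support_iff.1 hm, map_zero]
  have he : ∀ y : Fin n → ℂ, eval y p = L (EV n s y) := by
    intro y
    rw [EV, ← hG, eval_eq (fun i => C (y i)) G]
    rw [show eval y p = ∑ m ∈ G.support, eval y (monomial m (L (coeff m G))) from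
      map_sum _ _ _, map_sum]
    refine Finset.sum_congr rfl fun m _ => ?_
    rw [eval_monomial, Finsupp.prod]
    simp only [← map_pow, ← map_prod]
    rw [mul_comm (coeff m G), ← smul_eq_C_mul, map_smul, smul_eq_mul, mul_comm]
  have hp0 : p = 0 := by
    refine MvPolynomial.funext_set (fun _ => (fun t : ℝ => (t : ℂ)) '' Set.Ioi 0) ?_ ?_
    · intro i
      exact (Set.Ioi_infinite (0 : ℝ)).image (Complex.ofReal_injective.injOn)
    · intro y hy
      have hy' : ∀ i, ∃ t : ℝ, 0 < t ∧ (t : ℂ) = y i := fun i => by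
        simpa using hy i (Set.mem_univ i)
      choose t ht hty using hy'
      let w : En n := WithLp.toLp 2 t
      have hw : w ≠ 0 := by
        intro h0
        have := congrArg (fun v : En n => v ⟨0, by omega⟩) h0
        have h1 : t ⟨0, by omega⟩ = 0 := by simpa [w] using this
        exact (ht _).ne' h1
      have hwn : ‖w‖ ≠ 0 := norm_ne_zero_iff.2 hw
      have hy2 : y = fun i => (‖w‖ : ℂ) * (((‖w‖⁻¹ • w : En n) i : ℝ) : ℂ) := by
        funext i
        rw [← hty i, ← Complex.ofReal_mul]
        congr 1
        simp only [PiLp.smul_apply, smul_eq_mul]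
        rw [mul_inv_cancel_left₀ hwn]
      rw [he, hy2, EV_smul, map_smul, h _ (by rw [norm_smul, norm_inv, norm_norm, inv_mul_cancel₀ hwn])]
      simp
  intro m
  rw [← hp, hp0, coeff_zero]

lemma omega_ne (n : ℕ) (hn : 2 ≤ n) : (omegaN n : ℂ) ≠ 0 := by
  have : omegaN n ≠ 0 := by
    unfold omegaN sphereMeasure
    rw [Measure.toSphere_apply_univ, ENNReal.toReal_ne_zero]
    constructor
    · refine mul_ne_zero ?_ (measure_ball_pos _ _ one_pos).ne'
      simp; omega
    · exact ENNReal.mul_ne_top (by simp) measure_ball_lt_top.ne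
  exact_mod_cast this

lemma kernel_eq (n : ℕ) (hn : 2 ≤ n) (z : ℂ) (hz : z ≠ 0) (θ x : En n) (c : ℂ) :
    c * z⁻¹ ^ (n - 1) / rPow n z⁻¹ θ x = z * (c *
      (1 / (1 - (2 * ((inner ℝ θ x : ℝ) : ℂ) * z - ((‖x‖ : ℂ)) ^ 2 * z ^ 2)) ^ ((n : ℂ) / 2))) := by
  obtain ⟨m, rfl⟩ : ∃ m, n = m + 1 := ⟨n - 1, by omega⟩
  unfold rPow
  rw [show (1 - 2 * ((inner ℝ θ x : ℝ) : ℂ) / z⁻¹ + ((‖x‖ : ℂ)) ^ 2 / z⁻¹ ^ 2)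
    = (1 - (2 * ((inner ℝ θ x : ℝ) : ℂ) * z - ((‖x‖ : ℂ)) ^ 2 * z ^ 2)) by field_simp; ring]
  rw [Nat.add_sub_cancel, pow_succ, div_eq_mul_inv, mul_inv, mul_inv, inv_inv, ← inv_pow, inv_inv]
  have : z⁻¹ ^ m * z ^ m = 1 := by rw [← mul_pow, inv_mul_cancel₀ hz, one_pow]
  rw [one_div]
  linear_combination (c * z * (((1 - (2 * ((inner ℝ θ x : ℝ) : ℂ) * z - ((‖x‖ : ℂ)) ^ 2 * z ^ 2)) ^ (((m + 1 : ℕ) : ℂ) / 2))⁻¹)) * this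

lemma int_hasSum (n : ℕ) (ν : Measure (En n)) [IsFiniteMeasure ν] (R : ℝ) (hR : 0 ≤ R)
    (hν : ∀ᵐ x ∂ν, x ∈ closedBall (0 : En n) R) (P : MvPolynomial (Fin n) ℂ) (z : ℂ)
    (hz : 2 * R * ‖z‖ + R ^ 2 * ‖z‖ ^ 2 < 1) (θ : En n) (hθ : ‖θ‖ = 1) :
    HasSum (fun s => ∫ x, evalR P x * (evalR (EV n s (fun i => (θ i : ℂ))) x * z ^ s) ∂ν)
      (∫ x, evalR P x *
      (1 / (1 - (2 * ((inner ℝ θ x : ℝ) : ℂ) * z - ((‖x‖ : ℂ)) ^ 2 * z ^ 2)) ^ ((n : ℂ) / 2)) ∂ν) := by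
  obtain ⟨G, hG, hGb⟩ := hC_bound (n / 2) R z hR hz
  obtain ⟨c, hc⟩ := (isCompact_closedBall (0 : En n) R).exists_bound_of_continuousOn
    (evalR_cont P).continuousOn
  have hT : ∀ x ∈ closedBall (0 : En n) R, ‖((inner ℝ θ x : ℝ) : ℂ)‖ ≤ R ∧ ‖((‖x‖ : ℂ)) ^ 2‖ ≤ R ^ 2 := by
    intro x hx
    have hx' : ‖x‖ ≤ R := by simpa using hx
    constructor
    · rw [Complex.norm_real]
      refine (norm_inner_le_norm θ x).trans ?_
      rw [hθ, one_mul]; exact hx'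
    · rw [norm_pow, Complex.norm_real, norm_norm]; gcongr
  refine hasSum_integral_of_dominated_convergence (fun s _ => c * G s) ?_ ?_ ?_ ?_ ?_
  · intro s
    exact ((evalR_cont P).mul ((evalR_cont _).mul continuous_const)).aestronglyMeasurable
  · intro s
    filter_upwards [hν] with x hx
    rw [norm_mul, EV_evalR _ _ _ _ hθ]
    exact mul_le_mul (hc x hx) (hGb _ _ (hT x hx).1 (hT x hx).2 s) (norm_nonneg _)
      ((norm_nonneg _).trans (hc x hx))
  · exact Filter.Eventually.of_forall fun _ => hG.mul_left c
  · exact integrable_const _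
  · filter_upwards [hν] with x hx
    simp only [EV_evalR _ _ _ _ hθ]
    refine HasSum.mul_left _ (hC_hasSum _ _ _ _ (lt_of_le_of_lt ?_ hz))
    have h1 := (hT x hx).1
    have h2 := (hT x hx).2
    rw [norm_mul, norm_mul, norm_mul, norm_pow z, Complex.norm_ofNat]
    gcongr

lemma restP_hasSum (n : ℕ) (hn : 2 ≤ n) (R : ℝ) (hR : 0 ≤ R)
    {μ : SignedMeasure (En n)} (hμ : SuppIn μ (closedBall (0 : En n) R))
    (P : MvPolynomial (Fin n) ℂ) (z : ℂ) (hz0 : z ≠ 0)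
    (hz : 2 * R * ‖z‖ + R ^ 2 * ‖z‖ ^ 2 < 1) (θ : En n) (hθ : ‖θ‖ = 1) :
    HasSum (fun s => (omegaN n : ℂ)⁻¹ * (z * (Lfun hμ P (EV n s (fun i => (θ i : ℂ))) * z ^ s)))
      (restP μ P z⁻¹ θ) := by
  have h1 := int_hasSum n _ R hR (supp_pos hμ).1 P z hz θ hθ
  have h2 := int_hasSum n _ R hR (supp_pos hμ).2 P z hz θ hθ
  have h3 := ((h1.sub h2).mul_left z).mul_left ((omegaN n : ℂ)⁻¹)
  unfold restP sInt
  simp only [kernel_eq n hn z hz0 θ, integral_const_mul]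
  rw [← mul_sub]
  refine hasSum_of_eq (fun s => ?_) h3
  simp only [Lfun, sInt, LinearMap.coe_mk, AddHom.coe_mk, ← mul_assoc, integral_mul_const]
  ring

lemma coeff_eq (n : ℕ) (hn : 2 ≤ n) (R : ℝ)
    (μ : SignedMeasure (En n)) (hμ : SuppIn μ (closedBall (0 : En n) R))
    (P : MvPolynomial (Fin n) ℂ)
    (r : ℕ → (sphere (0 : En n) 1) → ℂ)
    (hr : ∀ θ : sphere (0 : En n) 1, ∀ ζ : ℂ, R < ‖ζ‖ →
      HasSum (fun s : ℕ => r s θ * ζ ^ (-(s : ℤ) - 1)) (restP μ P ζ (θ : En n)))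
    (θ : sphere (0 : En n) 1) (s : ℕ) :
    r s θ = (omegaN n : ℂ)⁻¹ * Lfun hμ P (EV n s (fun i => ((θ : En n) i : ℂ))) := by
  set R' := max R 0 with hR'
  have hR0 : 0 ≤ R' := le_max_right _ _
  have hμ' : SuppIn μ (closedBall (0 : En n) R') :=
    measure_mono_null (Set.compl_subset_compl.2 (closedBall_subset_closedBall (le_max_left _ _))) hμ
  have hθ : ‖(θ : En n)‖ = 1 := by simpa using θ.2
  have key := coeff_unique
    (fun s => r s θ - (omegaN n : ℂ)⁻¹ * Lfun hμ P (EV n s (fun i => ((θ : En n) i : ℂ))))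
    (1 / (4 * (R' + 1))) (by positivity) ?_
  · have := congrFun key s
    exact sub_eq_zero.1 this
  · intro z hz0 hz
    have hzn : 0 < ‖z‖ := norm_pos_iff.2 hz0
    have hz' : 4 * (R' + 1) * ‖z‖ < 1 := by
      rw [lt_div_iff₀ (by positivity)] at hz; linarith
    have hRz : R' * ‖z‖ < 1 / 4 := by nlinarith
    have hRz0 : 0 ≤ R' * ‖z‖ := by positivity
    have h1 := hr θ z⁻¹ (by
      rw [norm_inv]
      refine lt_of_le_of_lt (le_max_left R 0) ?_
      rw [← one_div, lt_div_iff₀ hzn]; linarith)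
    have h2 := restP_hasSum n hn R' hR0 hμ' P z hz0 (by nlinarith) θ hθ
    have h3 := (h1.sub h2).mul_left z⁻¹
    rw [sub_self, mul_zero] at h3
    refine hasSum_of_eq (fun s => ?_) h3
    have h4 : z⁻¹ ^ (-(s : ℤ) - 1) = z * z ^ s := by
      rw [inv_zpow, ← zpow_neg, show -(-(s : ℤ) - 1) = ((s + 1 : ℕ) : ℤ) by push_cast; ring,
        zpow_natCast, pow_succ']
    rw [h4]
    have h5 : Lfun hμ' P (EV n s (fun i => ((θ : En n) i : ℂ))) =
      Lfun hμ P (EV n s (fun i => ((θ : En n) i : ℂ))) := rfl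
    rw [h5]
    field_simp

end Main

/-- `P` is orthogonal to all polynomials of degree `< M` with
respect to `μ` iff the first `M` Laurent coefficient functions of the rest
function `R_P` vanish. -/
theorem orthogonality_iff_laurent_coefficients_vanish
    (n : ℕ) (hn : 2 ≤ n) (R : ℝ)
    (μ : SignedMeasure (En n)) (hμ : SuppIn μ (closedBall (0 : En n) R))
    (P : MvPolynomial (Fin n) ℂ) (M : ℕ)
    (r : ℕ → (sphere (0 : En n) 1) → ℂ)
    (hr : ∀ θ : sphere (0 : En n) 1, ∀ ζ : ℂ, R < ‖ζ‖ →
      HasSum (fun s : ℕ => r s θ * ζ ^ (-(s : ℤ) - 1)) (restP μ P ζ (θ : En n))) :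
    (∀ Q : MvPolynomial (Fin n) ℂ, Q.totalDegree < M →
        sInt μ (fun x => evalR P x * evalR Q x) = 0)
      ↔ (∀ s : ℕ, s < M → ∀ θ : sphere (0 : En n) 1, r s θ = 0) := by
  have hω := omega_ne n hn
  have hc := coeff_eq n hn R μ hμ P r hr
  constructor
  · intro h s hs θ
    rw [hc]
    have : Lfun hμ P (EV n s (fun i => ((θ : En n) i : ℂ))) = 0 :=
      h _ (lt_of_le_of_lt (EV_hom n s _).totalDegree_le hs)
    rw [this, mul_zero]
  · intro h Q hQ
    change Lfun hμ P Q = 0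
    have hmon : ∀ m : Fin n →₀ ℕ, m.degree < M → Lfun hμ P (monomial m 1) = 0 := by
      intro m hm
      have h1 : Kil (Lfun hμ P) (vB (A := MvPolynomial (Fin n) ℂ) (fun i : Fin n => X i) m.degree (n / 2)) := by
        refine Kil_of_sphere n m.degree hn _ fun θ hθ => ?_
        have h2 := hc ⟨θ, by simpa using hθ⟩ m.degree
        rw [h _ hm] at h2
        rcases mul_eq_zero.1 h2.symm with h3 | h3
        · exact absurd h3 (inv_ne_zero hω)
        · exact h3
      have h2 := Kil.monom (fun i : Fin n => (X i : MvPolynomial (Fin n) ℂ)) m.degree 1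
        (by simpa using Kil.top _ _ h1 hn) m rfl
      rwa [one_mul, ← monic_monomial_eq] at h2
    rw [Q.as_sum, map_sum]
    refine Finset.sum_eq_zero fun m hm => ?_
    have h1 : monomial m (coeff m Q) = coeff m Q • (monomial m (1 : ℂ)) := by
      rw [smul_monomial, smul_eq_mul, mul_one]
    rw [h1, map_smul, hmon m (lt_of_le_of_lt (le_totalDegree hm) hQ), smul_zero]
end
end
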